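/- arXiv:2304.04799 — 2 statements merged into one kernel-verified Lean document; each statement's English description precedes it below -/
import Mathlib

section
/- Let d ≤ m, let Ξ be an integer d×m matrix whose first d columns are linearly independent, and let r(Ξ) be the minimal number of columns that can be removed from Ξ so that the remaining columns do not span ℝ^d. Then the span of the integer shifts of M_Ξ reproduces all polynomials of total degree at most r(Ξ) − 1: for every polynomial p : ℝ^d → ℝ with deg p ≤ r(Ξ) − 1 there exists c : ℤ^d → ℝ such that for every x ∈ ℝ^d, ∑_{j ∈ ℤ^d} c(j) M_Ξ(x − j) = p(x), the sum having only finitely many nonzero terms for each x. -/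
open MeasureTheory

/-- The centered box spline for a `d × (d+n)` direction matrix, by recursion on `n`:
for `n = 0` it is the normalized indicator of the half-open parallelepiped
`Ξ [-1/2,1/2)^d`; for `n+1` it is the average of the translates of the box spline of
`Ξ` with its last column removed, in the direction of that last column. -/
noncomputable def boxSplineAux (d : ℕ) : (n : ℕ) → Matrix (Fin d) (Fin (d + n)) ℝ → ((Fin d → ℝ) → ℝ)
  | 0, Ξ => fun x =>
      Set.indicator
        {y : Fin d → ℝ | ∃ t : Fin d → ℝ, (∀ i, t i ∈ Set.Ico (-(1:ℝ)/2) (1/2)) ∧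
          y = Matrix.mulVec (Matrix.of fun (i j : Fin d) => Ξ i (Fin.cast (Nat.add_zero d).symm j)) t}
        (fun _ => |Matrix.det (Matrix.of fun (i j : Fin d) => Ξ i (Fin.cast (Nat.add_zero d).symm j))|⁻¹) x
  | (n+1), Ξ => fun x =>
      ∫ t in (-(1:ℝ)/2)..(1/2),
        boxSplineAux d n (fun i j => Ξ i (Fin.castSucc j)) (x - t • fun i => Ξ i (Fin.last (d + n)))

/-- The centered box spline `M_Ξ` of a `d × m` direction matrix `Ξ`, `d ≤ m`. -/
noncomputable def boxSpline {d m : ℕ} (hdm : d ≤ m) (Ξ : Matrix (Fin d) (Fin m) ℝ) :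
    (Fin d → ℝ) → ℝ :=
  boxSplineAux d (m - d) (fun i j => Ξ i (Fin.cast (Nat.add_sub_cancel' hdm) j))

/-- `boxSplineR Ξ` : the minimal number of columns that can be removed from `Ξ` so that
the remaining columns do not span `ℝ^d`. -/
noncomputable def boxSplineR {d m : ℕ} (Ξ : Matrix (Fin d) (Fin m) ℝ) : ℕ :=
  sInf {k : ℕ | ∃ S : Finset (Fin m), S.card = k ∧
    Submodule.span ℝ ((fun j => fun i => Ξ i j) '' (↑Sᶜ : Set (Fin m))) ≠ ⊤}

section Torus

/-- The Haar probability measure on `ℝ / ℤ`. -/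
noncomputable local instance unitAddCircleMeasureSpace : MeasureSpace UnitAddCircle :=
  ⟨AddCircle.haarAddCircle⟩

local instance : IsProbabilityMeasure (volume : Measure UnitAddCircle) :=
  inferInstanceAs (IsProbabilityMeasure AddCircle.haarAddCircle)

theorem UnitAddTorus.ae_eq_const_of_mFourierCoeff_eq_zero {d : Type*} [Fintype d]
    {f : UnitAddTorus d → ℂ} (hf : MemLp f 2 volume)
    (h0 : ∀ k : d → ℤ, k ≠ 0 → UnitAddTorus.mFourierCoeff f k = 0) :
    ∃ c : ℂ, ∀ᵐ z, f z = c := by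
  have hco : ∀ k, UnitAddTorus.mFourierCoeff (hf.toLp f) k = UnitAddTorus.mFourierCoeff f k :=
    fun k => integral_congr_ae (by
      filter_upwards [hf.coeFn_toLp] with z hz
      rw [hz])
  have hs := UnitAddTorus.hasSum_mFourier_series_L2 (hf.toLp f)
  have hs' := hasSum_single (f := fun i => UnitAddTorus.mFourierCoeff (hf.toLp f) i •
    UnitAddTorus.mFourierLp 2 i) 0 (fun k hk => by simp only [hco, h0 k hk, zero_smul])
  have he := hs.unique hs'
  refine ⟨UnitAddTorus.mFourierCoeff (hf.toLp f) 0, ?_⟩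
  have h1 := hf.coeFn_toLp
  rw [he] at h1
  filter_upwards [h1, Lp.coeFn_smul (UnitAddTorus.mFourierCoeff (hf.toLp f) 0)
    (UnitAddTorus.mFourierLp (d := d) 2 0), UnitAddTorus.coeFn_mFourierLp (d := d) 2 0] with z a b c
  rw [← a, b, Pi.smul_apply, c, UnitAddTorus.mFourier_zero]
  simp

theorem measurableSet_unitCube {d : ℕ} :
    MeasurableSet {x : Fin d → ℝ | ∀ i, x i ∈ Set.Ioc (0 : ℝ) (0 + 1)} := by
  have : {x : Fin d → ℝ | ∀ i, x i ∈ Set.Ioc (0 : ℝ) (0 + 1)} =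
      Set.univ.pi fun _ => Set.Ioc (0 : ℝ) (0 + 1) := by
    ext; simp
  rw [this]
  exact MeasurableSet.univ_pi fun _ => measurableSet_Ioc

theorem ae_eq_const_of_integral_exp_eq_zero {d : ℕ} {h : (Fin d → ℝ) → ℂ} (hm : Measurable h)
    {C : ℝ} (hC : ∀ x, ‖h x‖ ≤ C)
    (h0 : ∀ k : Fin d → ℤ, k ≠ 0 → ∫ x in {x : Fin d → ℝ | ∀ i, x i ∈ Set.Ioc (0 : ℝ) (0 + 1)},
      Complex.exp (2 * Real.pi * Complex.I * ((∑ i, (k i : ℝ) * x i : ℝ) : ℂ)) * h x = 0) :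
    ∃ c : ℂ, ∀ᵐ x ∂volume.restrict {x : Fin d → ℝ | ∀ i, x i ∈ Set.Ioc (0 : ℝ) (0 + 1)},
      h x = c := by
  set Q : Set (Fin d → ℝ) := {x | ∀ i, x i ∈ Set.Ioc (0 : ℝ) (0 + 1)}
  have hQm : MeasurableSet Q := measurableSet_unitCube
  let f : UnitAddTorus (Fin d) → ℂ :=
    fun z => h (UnitAddTorus.measurableEquivPiIoc (fun _ => (0 : ℝ)) z).1
  have hfm : Measurable f := hm.comp
    (measurable_subtype_coe.comp (UnitAddTorus.measurableEquivPiIoc _).measurable)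
  have hfx : ∀ x ∈ Q, f (fun i => (x i : UnitAddCircle)) = h x := by
    intro x hx
    have := (UnitAddTorus.measurableEquivPiIoc (fun _ => (0 : ℝ))).apply_symm_apply ⟨x, hx⟩
    simp only [UnitAddTorus.coe_symm_measurableEquivPiIoc_apply] at this
    simp only [f, this]
  have hf : MemLp f 2 volume := by
    refine MemLp.of_bound hfm.aestronglyMeasurable C (Filter.Eventually.of_forall fun z => hC _)
  obtain ⟨c, hc⟩ := UnitAddTorus.ae_eq_const_of_mFourierCoeff_eq_zero hf (by
    intro k hk
    rw [UnitAddTorus.mFourierCoeff_eq_integral f k (fun _ => 0), ← h0 (-k) (by simpa using hk)]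
    refine setIntegral_congr_fun hQm fun x hx => ?_
    simp only [hfx x hx, smul_eq_mul, UnitAddTorus.mFourier, ContinuousMap.coe_mk]
    congr 1
    simp only [fourier_coe_apply, ← Complex.exp_sum]
    congr 1
    push_cast
    rw [Finset.mul_sum]
    refine Finset.sum_congr rfl fun i _ => ?_
    simp
    ring)
  refine ⟨c, ?_⟩
  have hl : ∫⁻ z, ‖f z - c‖ₑ = 0 := by
    rw [lintegral_eq_zero_iff (hfm.sub_const c).enorm]
    filter_upwards [hc] with z hz
    simp [hz]
  rw [UnitAddTorus.lintegral_preimage _ (fun _ => 0),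
    setLIntegral_congr_fun hQm (g := fun x => ‖h x - c‖ₑ) (fun x hx => by simp only [hfx x hx]),
    lintegral_eq_zero_iff (hm.sub_const c).enorm] at hl
  filter_upwards [hl] with x hx
  simpa [sub_eq_zero] using hx

end Torus

section Polynomials

open MvPolynomial

/-- The real polynomials in `d` variables all of whose monomials have degree less than `k`. -/
noncomputable def degLT (d k : ℕ) : Submodule ℝ (MvPolynomial (Fin d) ℝ) :=
  restrictSupport ℝ {s | s.degree < k}

variable {d : ℕ}

theorem degLT_mono {k l : ℕ} (h : k ≤ l) : degLT d k ≤ degLT d l :=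
  restrictSupport_mono _ fun _ hs => lt_of_lt_of_le hs h

theorem eq_zero_of_mem_degLT_zero {q : MvPolynomial (Fin d) ℝ} (hq : q ∈ degLT d 0) : q = 0 := by
  rw [degLT, mem_restrictSupport_iff] at hq
  rw [← support_eq_empty, Finset.eq_empty_iff_forall_notMem]
  intro s hs
  simpa using hq hs

theorem C_mem_degLT (a : ℝ) (k : ℕ) : (C a : MvPolynomial (Fin d) ℝ) ∈ degLT d (k + 1) := by
  rw [C_apply, degLT, monomial_mem_restrictSupport]
  simp

theorem mul_X_mem_degLT {k : ℕ} {q : MvPolynomial (Fin d) ℝ} (hq : q ∈ degLT d k) (i : Fin d) :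
    q * X i ∈ degLT d (k + 1) := by
  rw [degLT, mem_restrictSupport_iff] at hq ⊢
  intro s hs
  rw [Finset.mem_coe, support_mul_X, Finset.mem_map] at hs
  obtain ⟨t, ht, rfl⟩ := hs
  have := hq ht
  simpa using this

theorem mem_degLT_of_totalDegree {q : MvPolynomial (Fin d) ℝ} {k : ℕ} (h : q.totalDegree < k) :
    q ∈ degLT d k := by
  rw [degLT, mem_restrictSupport_iff]
  exact fun s hs => lt_of_le_of_lt (le_totalDegree hs) h

theorem monomial_degree_induction {P : ℕ → MvPolynomial (Fin d) ℝ → Prop} (h1 : P 0 1)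
    (hX : ∀ n q i, P n q → P (n + 1) (q * X i)) (s : Fin d →₀ ℕ) : P s.degree (monomial s 1) := by
  generalize hn : s.degree = n
  induction n generalizing s with
  | zero =>
    have : s = 0 := (Finsupp.degree_eq_zero_iff s).mp hn
    subst this
    simpa using h1
  | succ n ih =>
    have hs : s ≠ 0 := by
      rintro rfl
      simp at hn
    obtain ⟨i, hi⟩ := Finsupp.ne_iff.mp hs
    have hle : Finsupp.single i 1 ≤ s := by
      simpa [Finsupp.single_le_iff, Nat.one_le_iff_ne_zero] using hi
    obtain ⟨t, rfl⟩ := exists_add_of_le hle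
    have ht : t.degree = n := by
      simp only [map_add, Finsupp.degree_single] at hn
      omega
    have := hX n _ i (ih t ht)
    rwa [X, monomial_mul, one_mul, add_comm t] at this

theorem degLT_induction {k : ℕ} {P : MvPolynomial (Fin d) ℝ → Prop} (h0 : P 0)
    (hadd : ∀ p q, P p → P q → P (p + q)) (hsmul : ∀ (a : ℝ) p, P p → P (a • p))
    (hmon : ∀ s : Fin d →₀ ℕ, s.degree < k → P (monomial s 1)) {q : MvPolynomial (Fin d) ℝ}
    (hq : q ∈ degLT d k) : P q := by
  rw [degLT, restrictSupport_eq_span] at hq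
  induction hq using Submodule.span_induction with
  | mem x hx =>
    obtain ⟨s, hs, rfl⟩ := hx
    exact hmon s hs
  | zero => exact h0
  | add x y _ _ hx hy => exact hadd x y hx hy
  | smul a x _ hx => exact hsmul a x hx

theorem exists_translate_sub_mem_degLT (v : Fin d → ℝ) {k : ℕ} {q : MvPolynomial (Fin d) ℝ}
    (hq : q ∈ degLT d k) :
    ∃ g ∈ degLT d (k - 1), ∀ y, eval (y + v) q = eval y q + eval y g := by
  refine degLT_induction (P := fun q => ∃ g ∈ degLT d (k - 1),
    ∀ y, eval (y + v) q = eval y q + eval y g) ⟨0, zero_mem _, by simp⟩ ?_ ?_ (fun s hs => ?_) hq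
  · rintro p q ⟨g, hg, h⟩ ⟨g', hg', h'⟩
    exact ⟨g + g', add_mem hg hg', fun y => by simp only [map_add, h, h']; ring⟩
  · rintro a p ⟨g, hg, h⟩
    exact ⟨a • g, Submodule.smul_mem _ _ hg, fun y => by simp only [smul_eval, h]; ring⟩
  · suffices H : (monomial s 1 : MvPolynomial (Fin d) ℝ) ∈ degLT d (s.degree + 1) ∧
        ∃ g ∈ degLT d s.degree, ∀ y, eval (y + v) (monomial s (1 : ℝ)) =
          eval y (monomial s 1) + eval y g by
      obtain ⟨-, g, hg, h⟩ := H
      exact ⟨g, degLT_mono (by omega) hg, h⟩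
    refine monomial_degree_induction (P := fun n q => q ∈ degLT d (n + 1) ∧
        ∃ g ∈ degLT d n, ∀ y, eval (y + v) q = eval y q + eval y g) ?_ ?_ s
    · exact ⟨by simpa using C_mem_degLT 1 0, 0, zero_mem _, by simp⟩
    · rintro n q i ⟨hq, g, hg, h⟩
      refine ⟨mul_X_mem_degLT hq i, g * X i + v i • (q + g), ?_, fun y => ?_⟩
      · exact add_mem (mul_X_mem_degLT hg i)
          (Submodule.smul_mem _ _ (add_mem hq (degLT_mono n.le_succ hg)))
      · simp only [map_mul, eval_X, h, map_add, smul_eval, Pi.add_apply]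
        ring

end Polynomials

section BoxSpline

variable {d n : ℕ}

/-- The square matrix consisting of the first `d` columns. -/
def firstCols (Ξ : Matrix (Fin d) (Fin (d + n)) ℝ) : Matrix (Fin d) (Fin d) ℝ :=
  Matrix.of fun i j => Ξ i (Fin.castAdd n j)

/-- All columns but the last. -/
def dropLastCol (Ξ : Matrix (Fin d) (Fin (d + (n + 1))) ℝ) : Matrix (Fin d) (Fin (d + n)) ℝ :=
  fun i j => Ξ i (Fin.castSucc j)

/-- The last column. -/
def lastCol (Ξ : Matrix (Fin d) (Fin (d + (n + 1))) ℝ) : Fin d → ℝ :=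
  fun i => Ξ i (Fin.last (d + n))

theorem firstCols_dropLastCol (Ξ : Matrix (Fin d) (Fin (d + (n + 1))) ℝ) :
    firstCols (dropLastCol Ξ) = firstCols Ξ := rfl

theorem boxSplineAux_succ (Ξ : Matrix (Fin d) (Fin (d + (n + 1))) ℝ) (x : Fin d → ℝ) :
    boxSplineAux d (n + 1) Ξ x =
      ∫ t in (-(1 : ℝ) / 2)..(1 / 2), boxSplineAux d n (dropLastCol Ξ) (x - t • lastCol Ξ) := rfl

/-- The half-open centered unit cube. -/
def centeredCube (d : ℕ) : Set (Fin d → ℝ) := Set.univ.pi fun _ => Set.Ico (-(1 : ℝ) / 2) (1 / 2)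

theorem measurableSet_centeredCube : MeasurableSet (centeredCube d) :=
  MeasurableSet.univ_pi fun _ => measurableSet_Ico

theorem boxSplineAux_zero {Ξ : Matrix (Fin d) (Fin (d + 0)) ℝ} (hΞ : (firstCols Ξ).det ≠ 0)
    (x : Fin d → ℝ) :
    boxSplineAux d 0 Ξ x = (centeredCube d).indicator (fun _ => |(firstCols Ξ).det|⁻¹)
      (Matrix.mulVec (firstCols Ξ)⁻¹ x) := by
  have hu : IsUnit (firstCols Ξ).det := isUnit_iff_ne_zero.mpr hΞ
  have key : x ∈ {y : Fin d → ℝ | ∃ t : Fin d → ℝ, (∀ i, t i ∈ Set.Ico (-(1:ℝ)/2) (1/2)) ∧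
      y = Matrix.mulVec (firstCols Ξ) t} ↔
      Matrix.mulVec (firstCols Ξ)⁻¹ x ∈ centeredCube d := by
    simp only [centeredCube, Set.mem_univ_pi]
    constructor
    · rintro ⟨t, ht, rfl⟩
      rwa [Matrix.mulVec_mulVec, Matrix.nonsing_inv_mul _ hu, Matrix.one_mulVec]
    · intro h
      exact ⟨_, h, by rw [Matrix.mulVec_mulVec, Matrix.mul_nonsing_inv _ hu, Matrix.one_mulVec]⟩
  change Set.indicator {y : Fin d → ℝ | ∃ t : Fin d → ℝ,
    (∀ i, t i ∈ Set.Ico (-(1:ℝ)/2) (1/2)) ∧ y = Matrix.mulVec (firstCols Ξ) t}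
    (fun _ => |(firstCols Ξ).det|⁻¹) x = _
  by_cases h : Matrix.mulVec (firstCols Ξ)⁻¹ x ∈ centeredCube d
  · rw [Set.indicator_of_mem h, Set.indicator_of_mem (key.mpr h)]
  · rw [Set.indicator_of_notMem h, Set.indicator_of_notMem (mt key.mp h)]

theorem measurable_boxSplineAux {Ξ : Matrix (Fin d) (Fin (d + n)) ℝ}
    (hΞ : (firstCols Ξ).det ≠ 0) : Measurable (boxSplineAux d n Ξ) := by
  induction n with
  | zero =>
    simp only [funext (boxSplineAux_zero hΞ)]
    exact (measurable_const.indicator measurableSet_centeredCube).comp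
      (Continuous.matrix_mulVec continuous_const continuous_id).measurable
  | succ n ih =>
    have h := ih (Ξ := dropLastCol Ξ) hΞ
    simp only [funext (boxSplineAux_succ Ξ),
      intervalIntegral.integral_of_le (show (-(1 : ℝ) / 2) ≤ 1 / 2 by norm_num)]
    refine (StronglyMeasurable.integral_prod_right (f := fun x (t : ℝ) =>
      boxSplineAux d n (dropLastCol Ξ) (x - t • lastCol Ξ)) ?_).measurable
    exact (h.comp (by fun_prop :
      Measurable fun p : (Fin d → ℝ) × ℝ => p.1 - p.2 • lastCol Ξ)).stronglyMeasurable

theorem exists_bound_boxSplineAux {Ξ : Matrix (Fin d) (Fin (d + n)) ℝ}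
    (hΞ : (firstCols Ξ).det ≠ 0) :
    ∃ C R : ℝ, ∀ x, ‖boxSplineAux d n Ξ x‖ ≤ C ∧ (R < ‖x‖ → boxSplineAux d n Ξ x = 0) := by
  induction n with
  | zero =>
    have hu : IsUnit (firstCols Ξ).det := isUnit_iff_ne_zero.mpr hΞ
    obtain ⟨R, hR⟩ := ((isCompact_univ_pi fun _ : Fin d => isCompact_Icc (a := -(1 : ℝ) / 2)
      (b := 1 / 2)).image (Continuous.matrix_mulVec (continuous_const (y := firstCols Ξ))
        continuous_id)).isBounded.exists_norm_le
    refine ⟨|(firstCols Ξ).det|⁻¹, R, fun x => ⟨?_, fun hx => ?_⟩⟩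
    · rw [boxSplineAux_zero hΞ]
      refine (norm_indicator_le_norm_self _ _).trans ?_
      simp
    · rw [boxSplineAux_zero hΞ]
      refine Set.indicator_of_notMem (fun h => ?_) _
      refine absurd (hR x ⟨_, fun i _ => Set.Ico_subset_Icc_self (h i trivial), ?_⟩) (not_le.mpr hx)
      change Matrix.mulVec (firstCols Ξ) (Matrix.mulVec (firstCols Ξ)⁻¹ x) = x
      rw [Matrix.mulVec_mulVec, Matrix.mul_nonsing_inv _ hu, Matrix.one_mulVec]
  | succ n ih =>
    obtain ⟨C, R, h⟩ := ih (Ξ := dropLastCol Ξ) hΞ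
    refine ⟨C, R + ‖lastCol Ξ‖, fun x => ⟨?_, fun hx => ?_⟩⟩
    · rw [boxSplineAux_succ]
      refine (intervalIntegral.norm_integral_le_of_norm_le_const fun t _ => (h _).1).trans ?_
      norm_num
    · rw [boxSplineAux_succ]
      refine (intervalIntegral.integral_congr fun t ht => ?_).trans
        intervalIntegral.integral_zero
      refine (h _).2 ?_
      rw [Set.uIcc_of_le (by norm_num)] at ht
      have h1 : ‖t • lastCol Ξ‖ ≤ ‖lastCol Ξ‖ := by
        rw [norm_smul]
        refine mul_le_of_le_one_left (norm_nonneg _) ?_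
        rw [Real.norm_eq_abs, abs_le]
        constructor <;> linarith [ht.1, ht.2]
      linarith [norm_sub_norm_le x (t • lastCol Ξ)]

theorem integrable_mul_boxSplineAux {Ξ : Matrix (Fin d) (Fin (d + n)) ℝ}
    (hΞ : (firstCols Ξ).det ≠ 0) {g : (Fin d → ℝ) → ℂ} (hg : Continuous g) :
    Integrable fun y => g y * (boxSplineAux d n Ξ y : ℂ) := by
  obtain ⟨C, R, h⟩ := exists_bound_boxSplineAux hΞ
  obtain ⟨D, hD⟩ := (isCompact_closedBall (0 : Fin d → ℝ) R).exists_bound_of_continuousOn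
    hg.continuousOn
  have hsupp : Function.support (fun y => g y * (boxSplineAux d n Ξ y : ℂ)) ⊆
      Metric.closedBall 0 R := by
    intro y hy
    by_contra hy'
    refine hy ?_
    simp only [Metric.mem_closedBall, dist_zero_right, not_le] at hy'
    simp [(h y).2 hy']
  rw [← integrableOn_iff_integrable_of_support_subset hsupp]
  refine Measure.integrableOn_of_bounded (M := D * C) measure_closedBall_lt_top.ne
    (hg.measurable.mul (Complex.measurable_ofReal.comp
      (measurable_boxSplineAux hΞ))).aestronglyMeasurable ?_
  refine (ae_restrict_iff' measurableSet_closedBall).mpr (Filter.Eventually.of_forall fun y hy => ?_)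
  rw [norm_mul, Complex.norm_real]
  exact mul_le_mul (hD y hy) (h y).1 (norm_nonneg _) ((norm_nonneg _).trans (hD y hy))

theorem integral_mul_boxSplineAux_zero {Ξ : Matrix (Fin d) (Fin (d + 0)) ℝ}
    (hΞ : (firstCols Ξ).det ≠ 0) {g : (Fin d → ℝ) → ℂ} (hg : Continuous g) :
    ∫ y, g y * (boxSplineAux d 0 Ξ y : ℂ) =
      ∫ t in centeredCube d, g (Matrix.mulVec (firstCols Ξ) t) := by
  set B := firstCols Ξ with hB
  have hu : IsUnit B.det := isUnit_iff_ne_zero.mpr hΞ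
  have hmap := Real.map_matrix_volume_pi_eq_smul_volume_pi hΞ
  have hcont : Continuous fun t : Fin d → ℝ => Matrix.mulVec B t :=
    Continuous.matrix_mulVec continuous_const continuous_id
  have hcont' : Continuous fun t : Fin d → ℝ => Matrix.mulVec B⁻¹ t :=
    Continuous.matrix_mulVec continuous_const continuous_id
  have hm : Measurable fun y : Fin d → ℝ =>
      (centeredCube d).indicator (fun t => g (Matrix.mulVec B t)) (Matrix.mulVec B⁻¹ y) :=
    (((hg.comp hcont).measurable).indicator measurableSet_centeredCube).comp hcont'.measurable
  have h1 := integral_map (μ := volume) (φ := Matrix.toLin' B) hcont.measurable.aemeasurable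
    hm.aestronglyMeasurable
  rw [hmap, integral_smul_measure] at h1
  have h2 : ∀ t : Fin d → ℝ, Matrix.mulVec B⁻¹ (Matrix.toLin' B t) = t := fun t => by
    rw [Matrix.toLin'_apply, Matrix.mulVec_mulVec, Matrix.nonsing_inv_mul _ hu, Matrix.one_mulVec]
  simp only [h2, integral_indicator measurableSet_centeredCube] at h1
  rw [← h1, ← integral_smul]
  refine integral_congr_ae (Filter.Eventually.of_forall fun y => ?_)
  simp only [boxSplineAux_zero hΞ, ← hB]
  by_cases hy : Matrix.mulVec B⁻¹ y ∈ centeredCube d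
  · rw [Set.indicator_of_mem hy, Set.indicator_of_mem hy, Matrix.mulVec_mulVec,
      Matrix.mul_nonsing_inv _ hu, Matrix.one_mulVec, ENNReal.toReal_ofReal (abs_nonneg _),
      abs_inv, Complex.real_smul, mul_comm]
  · simp [Set.indicator_of_notMem hy]

theorem integral_mul_boxSplineAux_succ {Ξ : Matrix (Fin d) (Fin (d + (n + 1))) ℝ}
    (hΞ : (firstCols Ξ).det ≠ 0) {g : (Fin d → ℝ) → ℂ} (hg : Continuous g) :
    ∫ y, g y * (boxSplineAux d (n + 1) Ξ y : ℂ) =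
      ∫ t in (-(1 : ℝ) / 2)..(1 / 2),
        ∫ y, g (y + t • lastCol Ξ) * (boxSplineAux d n (dropLastCol Ξ) y : ℂ) := by
  have hΞ' : (firstCols (dropLastCol Ξ)).det ≠ 0 := hΞ
  obtain ⟨C, R, h⟩ := exists_bound_boxSplineAux hΞ'
  obtain ⟨D, hD⟩ := (isCompact_closedBall (0 : Fin d → ℝ)
    (R + ‖lastCol Ξ‖)).exists_bound_of_continuousOn hg.continuousOn
  have hle : (-(1 : ℝ) / 2) ≤ 1 / 2 := by norm_num
  simp only [boxSplineAux_succ, ← intervalIntegral.integral_ofReal,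
    ← intervalIntegral.integral_const_mul]
  simp only [intervalIntegral.integral_of_le hle]
  rw [integral_integral_swap]
  · refine integral_congr_ae (Filter.Eventually.of_forall fun t => ?_)
    simp only
    rw [← integral_add_right_eq_self _ (t • lastCol Ξ)]
    simp
  · have hb : Integrable ((Metric.closedBall (0 : Fin d → ℝ) (R + ‖lastCol Ξ‖)).indicator
        fun _ => D * C) volume :=
      (integrable_indicator_iff measurableSet_closedBall).mpr
        (integrableOn_const measure_closedBall_lt_top.ne)
    have hmeas : Measurable fun p : (Fin d → ℝ) × ℝ =>
        g p.1 * (boxSplineAux d n (dropLastCol Ξ) (p.1 - p.2 • lastCol Ξ) : ℂ) :=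
      (hg.measurable.comp measurable_fst).mul (Complex.measurable_ofReal.comp
        ((measurable_boxSplineAux hΞ').comp (by fun_prop)))
    refine (hb.comp_fst (volume.restrict (Set.Ioc (-(1 : ℝ) / 2) (1 / 2)))).mono'
      hmeas.aestronglyMeasurable ?_
    have hae : ∀ᵐ p : (Fin d → ℝ) × ℝ ∂(volume.prod
        (volume.restrict (Set.Ioc (-(1 : ℝ) / 2) (1 / 2)))), p.2 ∈ Set.Ioc (-(1 : ℝ) / 2) (1 / 2) :=
      Measure.quasiMeasurePreserving_snd.ae (ae_restrict_mem measurableSet_Ioc)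
    filter_upwards [hae] with p hp
    simp only [Function.uncurry]
    by_cases hy : p.1 ∈ Metric.closedBall (0 : Fin d → ℝ) (R + ‖lastCol Ξ‖)
    · rw [Set.indicator_of_mem hy, norm_mul, Complex.norm_real]
      exact mul_le_mul (hD _ hy) (h _).1 (norm_nonneg _) ((norm_nonneg _).trans (hD _ hy))
    · rw [Set.indicator_of_notMem hy, (h _).2]
      · simp
      · simp only [Metric.mem_closedBall, dist_zero_right, not_le] at hy
        have h1 : ‖p.2 • lastCol Ξ‖ ≤ ‖lastCol Ξ‖ := by
          rw [norm_smul]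
          refine mul_le_of_le_one_left (norm_nonneg _) ?_
          rw [Real.norm_eq_abs, abs_le]
          constructor <;> linarith [hp.1, hp.2]
        linarith [norm_sub_norm_le p.1 (p.2 • lastCol Ξ)]

end BoxSpline

section Vanishing

open MvPolynomial Matrix

variable {d n : ℕ}

/-- The exponential `y ↦ exp (2πi w·y)`. -/
noncomputable def expDot (w y : Fin d → ℝ) : ℂ :=
  Complex.exp (2 * Real.pi * Complex.I * ((w ⬝ᵥ y : ℝ) : ℂ))

theorem continuous_expDot (w : Fin d → ℝ) : Continuous (expDot w) := by
  unfold expDot dotProduct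
  fun_prop

theorem expDot_add (w y z : Fin d → ℝ) : expDot w (y + z) = expDot w y * expDot w z := by
  rw [expDot, expDot, expDot, ← Complex.exp_add, dotProduct_add]
  congr 1
  push_cast
  ring

theorem expDot_eq_one_of_int {w y : Fin d → ℝ} {z : ℤ} (h : w ⬝ᵥ y = z) : expDot w y = 1 := by
  rw [expDot, h, Complex.exp_eq_one_iff]
  exact ⟨z, by push_cast; ring⟩

theorem continuous_ofReal_eval (q : MvPolynomial (Fin d) ℝ) :
    Continuous fun y : Fin d → ℝ => ((eval y q : ℝ) : ℂ) :=
  Complex.continuous_ofReal.comp (continuous_eval q)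

theorem continuous_eval_mul_expDot (w : Fin d → ℝ) (q : MvPolynomial (Fin d) ℝ) :
    Continuous fun y : Fin d → ℝ => ((eval y q : ℝ) : ℂ) * expDot w y :=
  (continuous_ofReal_eval q).mul (continuous_expDot w)

theorem intervalIntegral_exp_int_eq_zero {z : ℤ} (hz : z ≠ 0) :
    ∫ t : ℝ in (-(1 : ℝ) / 2)..(1 / 2), Complex.exp (2 * Real.pi * Complex.I * ((z * t : ℝ) : ℂ)) =
      0 := by
  have hc : (2 * Real.pi * Complex.I * z : ℂ) ≠ 0 := by
    simp [hz, Real.pi_ne_zero]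
  have h := integral_exp_mul_complex (a := -(1 : ℝ) / 2) (b := 1 / 2) hc
  have e : Complex.exp (2 * Real.pi * Complex.I * z * ((1 / 2 : ℝ) : ℂ)) =
      Complex.exp (2 * Real.pi * Complex.I * z * ((-(1 : ℝ) / 2 : ℝ) : ℂ)) := by
    rw [Complex.exp_eq_exp_iff_exists_int]
    exact ⟨z, by push_cast; ring⟩
  rw [e, sub_self, zero_div] at h
  rw [← h]
  refine intervalIntegral.integral_congr fun t _ => ?_
  congr 1
  push_cast
  ring

theorem integrableOn_centeredCube {g : (Fin d → ℝ) → ℂ} (hg : Continuous g) :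
    IntegrableOn g (centeredCube d) :=
  (hg.continuousOn.integrableOn_compact (isCompact_univ_pi fun _ => isCompact_Icc)).mono_set
    (Set.pi_mono fun _ _ => Set.Ico_subset_Icc_self)

theorem setIntegral_centeredCube_eval_mul_expDot {w : Fin d → ℝ} (hw : ∀ j, ∃ z : ℤ, w j = z)
    {q : MvPolynomial (Fin d) ℝ} (hq : q ∈ degLT d (Finset.univ.filter fun j => w j ≠ 0).card) :
    ∫ t in centeredCube d, ((eval t q : ℝ) : ℂ) * expDot w t = 0 := by
  have hcont := continuous_eval_mul_expDot w
  refine degLT_induction (P := fun q => ∫ t in centeredCube d, ((eval t q : ℝ) : ℂ) * expDot w t = 0)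
    (by simp) (fun p q hp hq => ?_) (fun a p hp => ?_) (fun s hs => ?_) hq
  · simp only [map_add, Complex.ofReal_add, add_mul]
    rw [integral_add (integrableOn_centeredCube (hcont p)) (integrableOn_centeredCube (hcont q)),
      hp, hq, add_zero]
  · simp only [smul_eval, Complex.ofReal_mul, mul_assoc]
    rw [integral_const_mul, hp, mul_zero]
  · obtain ⟨j, hj, hsj⟩ : ∃ j, w j ≠ 0 ∧ s j = 0 := by
      by_contra! h
      refine absurd hs (not_lt.mpr ?_)
      calc _ = ∑ j ∈ Finset.univ.filter (fun j => w j ≠ 0), 1 := by simp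
        _ ≤ ∑ j ∈ Finset.univ.filter (fun j => w j ≠ 0), s j := by
          refine Finset.sum_le_sum fun j hj => Nat.one_le_iff_ne_zero.mpr (h j ?_)
          simpa using hj
        _ ≤ ∑ j, s j := Finset.sum_le_sum_of_subset (Finset.filter_subset _ _)
        _ = s.degree := (Finsupp.degree_eq_sum s).symm
    have hprod : ∀ t : Fin d → ℝ, ((eval t (monomial s (1 : ℝ)) : ℝ) : ℂ) * expDot w t =
        ∏ i, ((t i : ℂ) ^ s i * Complex.exp (2 * Real.pi * Complex.I * ((w i * t i : ℝ) : ℂ))) := by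
      intro t
      rw [eval_monomial, one_mul, Finsupp.prod_fintype _ _ (by simp), Finset.prod_mul_distrib,
        ← Complex.exp_sum, expDot, dotProduct, ← Finset.mul_sum]
      push_cast
      rfl
    simp only [hprod]
    rw [centeredCube, volume_pi, Measure.restrict_pi_pi,
      integral_fintype_prod_eq_prod (μ := fun _ => volume.restrict (Set.Ico (-(1 : ℝ) / 2) (1 / 2)))
        (f := fun i (t : ℝ) => (t : ℂ) ^ s i *
          Complex.exp (2 * Real.pi * Complex.I * ((w i * t : ℝ) : ℂ)))]
    refine Finset.prod_eq_zero (Finset.mem_univ j) ?_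
    obtain ⟨z, hz⟩ := hw j
    rw [integral_Ico_eq_integral_Ioc, ← intervalIntegral.integral_of_le (by norm_num)]
    simp only [hsj, pow_zero, one_mul, hz]
    refine intervalIntegral_exp_int_eq_zero ?_
    rintro rfl
    simp [hz] at hj

theorem exists_comp_mulVec_mem_degLT (B : Matrix (Fin d) (Fin d) ℝ) {k : ℕ}
    {q : MvPolynomial (Fin d) ℝ} (hq : q ∈ degLT d k) :
    ∃ g ∈ degLT d k, ∀ t, eval (B *ᵥ t) q = eval t g := by
  refine degLT_induction (P := fun q => ∃ g ∈ degLT d k, ∀ t, eval (B *ᵥ t) q = eval t g)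
    ⟨0, zero_mem _, by simp⟩ ?_ ?_ (fun s hs => ?_) hq
  · rintro p q ⟨g, hg, h⟩ ⟨g', hg', h'⟩
    exact ⟨g + g', add_mem hg hg', fun y => by simp only [map_add, h, h']⟩
  · rintro a p ⟨g, hg, h⟩
    exact ⟨a • g, Submodule.smul_mem _ _ hg, fun y => by simp only [smul_eval, h]⟩
  · obtain ⟨g, hg, h⟩ := monomial_degree_induction (P := fun n q => ∃ g ∈ degLT d (n + 1),
      ∀ t, eval (B *ᵥ t) q = eval t g) ⟨1, by simpa using C_mem_degLT 1 0, by simp⟩ (by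
        rintro n q i ⟨g, hg, h⟩
        refine ⟨∑ j, B i j • (g * X j), Submodule.sum_mem _ fun j _ =>
          Submodule.smul_mem _ _ (mul_X_mem_degLT hg j), fun t => ?_⟩
        simp only [map_mul, h, eval_X, map_sum, smul_eval, mulVec, dotProduct, Finset.mul_sum]
        exact Finset.sum_congr rfl fun j _ => by ring) s
    exact ⟨g, degLT_mono hs hg, h⟩

theorem integral_boxSplineAux {Ξ : Matrix (Fin d) (Fin (d + n)) ℝ}
    (hΞ : (firstCols Ξ).det ≠ 0) : ∫ y, (1 : ℂ) * (boxSplineAux d n Ξ y : ℂ) = 1 := by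
  induction n with
  | zero =>
    rw [integral_mul_boxSplineAux_zero hΞ (g := fun _ => 1) continuous_const]
    have : volume.real (centeredCube d) = 1 := by
      rw [Measure.real, centeredCube, Real.volume_pi_Ico]
      norm_num
    simp [this]
  | succ n ih =>
    rw [integral_mul_boxSplineAux_succ hΞ (g := fun _ => 1) continuous_const]
    simp only [ih (Ξ := dropLastCol Ξ) hΞ]
    norm_num

theorem integral_eval_mul_expDot_mul_boxSplineAux {Ξ : Matrix (Fin d) (Fin (d + n)) ℝ}
    (hΞ : (firstCols Ξ).det ≠ 0) {w : Fin d → ℝ}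
    (hw : ∀ j, ∃ z : ℤ, w ⬝ᵥ (fun i => Ξ i j) = z) {q : MvPolynomial (Fin d) ℝ}
    (hq : q ∈ degLT d (Finset.univ.filter fun j => w ⬝ᵥ (fun i => Ξ i j) ≠ 0).card) :
    ∫ y, ((eval y q : ℝ) : ℂ) * expDot w y * (boxSplineAux d n Ξ y : ℂ) = 0 := by
  induction n generalizing q with
  | zero =>
    rw [integral_mul_boxSplineAux_zero hΞ (continuous_eval_mul_expDot w q)]
    obtain ⟨g, hg, h⟩ := exists_comp_mulVec_mem_degLT (firstCols Ξ) hq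
    have he : ∀ t, expDot w (firstCols Ξ *ᵥ t) = expDot (w ᵥ* firstCols Ξ) t := fun t => by
      rw [expDot, expDot, dotProduct_mulVec]
    simp only [h, he]
    exact setIntegral_centeredCube_eval_mul_expDot (w := w ᵥ* firstCols Ξ) hw hg
  | succ n ih =>
    have hcont := continuous_eval_mul_expDot w
    have hΞ' : (firstCols (dropLastCol Ξ)).det ≠ 0 := hΞ
    have hcard : (Finset.univ.filter fun j => w ⬝ᵥ (fun i => Ξ i j) ≠ 0).card =
        (Finset.univ.filter fun j => w ⬝ᵥ (fun i => dropLastCol Ξ i j) ≠ 0).card +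
          if w ⬝ᵥ lastCol Ξ ≠ 0 then 1 else 0 := by
      rw [Finset.card_filter, Finset.card_filter]
      exact Fin.sum_univ_castSucc (n := d + n)
        fun j => if w ⬝ᵥ (fun i => Ξ i j) ≠ 0 then 1 else 0
    have hih := fun {q} => ih (Ξ := dropLastCol Ξ) hΞ' (fun j => hw (Fin.castSucc j)) (q := q)
    rw [hcard] at hq
    rw [integral_mul_boxSplineAux_succ hΞ (hcont q)]
    by_cases hl : w ⬝ᵥ lastCol Ξ = 0
    · rw [if_neg (not_not.mpr hl), add_zero] at hq
      refine (intervalIntegral.integral_congr fun t _ => ?_).trans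
        intervalIntegral.integral_zero
      obtain ⟨g, hg, h⟩ := exists_translate_sub_mem_degLT (t • lastCol Ξ) hq
      have he : expDot w (t • lastCol Ξ) = 1 :=
        expDot_eq_one_of_int (z := 0) (by simp [dotProduct_smul, hl])
      have := hih (add_mem hq (degLT_mono (Nat.sub_le _ _) hg))
      simpa only [expDot_add, he, mul_one, h, map_add] using this
    · rw [if_pos hl] at hq
      have key : ∀ t : ℝ, ∫ y, ((eval (y + t • lastCol Ξ) q : ℝ) : ℂ) *
          expDot w (y + t • lastCol Ξ) * (boxSplineAux d n (dropLastCol Ξ) y : ℂ) =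
          expDot w (t • lastCol Ξ) *
            ∫ y, ((eval y q : ℝ) : ℂ) * expDot w y * (boxSplineAux d n (dropLastCol Ξ) y : ℂ) := by
        intro t
        obtain ⟨g, hg, h⟩ := exists_translate_sub_mem_degLT (t • lastCol Ξ) hq
        have h0 := hih (by simpa using hg)
        rw [← integral_const_mul, ← add_zero (∫ y, _ * (_ * _ * _)),
          ← mul_zero (expDot w (t • lastCol Ξ)), ← h0, ← integral_const_mul, ← integral_add]
        · refine integral_congr_ae (Filter.Eventually.of_forall fun y => ?_)
          simp only [h, expDot_add, Complex.ofReal_add]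
          ring
        · exact (integrable_mul_boxSplineAux hΞ' (hcont q)).const_mul _
        · exact (integrable_mul_boxSplineAux hΞ' (hcont g)).const_mul _
      simp only [key]
      rw [intervalIntegral.integral_mul_const]
      obtain ⟨z, hz⟩ := hw (Fin.last (d + n))
      have hz0 : z ≠ 0 := by
        rintro rfl
        exact hl (hz.trans Int.cast_zero)
      have := intervalIntegral_exp_int_eq_zero hz0
      have he : ∀ t : ℝ, expDot w (t • lastCol Ξ) =
          Complex.exp (2 * Real.pi * Complex.I * ((z * t : ℝ) : ℂ)) := fun t => by
        rw [expDot, dotProduct_smul, smul_eq_mul, mul_comm t, ← hz]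
        rfl
      simp only [he, this, zero_mul]

end Vanishing

section Cone

open Filter Topology Matrix

variable {d n : ℕ}

/-- The open cone spanned by the columns of an invertible matrix `B`. -/
def openCone (B : Matrix (Fin d) (Fin d) ℝ) : Set (Fin d → ℝ) := {y | ∀ i, 0 < (B⁻¹ *ᵥ y) i}

theorem continuous_mulVec_apply (B : Matrix (Fin d) (Fin d) ℝ) (i : Fin d) :
    Continuous fun y : Fin d → ℝ => (B *ᵥ y) i :=
  (continuous_apply i).comp (Continuous.matrix_mulVec continuous_const continuous_id)

theorem isOpen_openCone (B : Matrix (Fin d) (Fin d) ℝ) : IsOpen (openCone B) := by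
  simp only [openCone, Set.ofPred_forall]
  exact isOpen_iInter_of_finite fun i => isOpen_lt continuous_const (continuous_mulVec_apply _ i)

theorem eventually_nhdsGT_add_mem_Ico_iff (u a b : ℝ) :
    ∀ᶠ s in 𝓝[>] (0 : ℝ), (u + s ∈ Set.Ico a b ↔ u ∈ Set.Ico a b) := by
  have hsmall : ∀ ε : ℝ, 0 < ε → ∀ᶠ s in 𝓝[>] (0 : ℝ), s < ε := fun ε hε =>
    nhdsWithin_le_nhds (gt_mem_nhds hε)
  have hpos : ∀ᶠ s in 𝓝[>] (0 : ℝ), 0 < s := self_mem_nhdsWithin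
  rcases lt_or_ge u a with h | h
  · filter_upwards [hsmall _ (sub_pos.mpr h)] with s hs
    exact ⟨fun h' => by linarith [h'.1], fun h' => by linarith [h'.1]⟩
  · rcases lt_or_ge u b with h' | h'
    · filter_upwards [hsmall _ (sub_pos.mpr h'), hpos] with s hs hs0
      exact ⟨fun _ => ⟨h, h'⟩, fun _ => ⟨by linarith, by linarith⟩⟩
    · filter_upwards [hpos] with s hs
      exact ⟨fun h'' => by linarith [h''.2], fun h'' => by linarith [h''.2]⟩

theorem tendsto_boxSplineAux_openCone {Ξ : Matrix (Fin d) (Fin (d + n)) ℝ}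
    (hΞ : (firstCols Ξ).det ≠ 0) (x : Fin d → ℝ) :
    Tendsto (fun y => boxSplineAux d n Ξ (x + y)) (𝓝[openCone (firstCols Ξ)] 0)
      (𝓝 (boxSplineAux d n Ξ x)) := by
  induction n generalizing x with
  | zero =>
    refine tendsto_const_nhds.congr' ?_
    have h : ∀ i, ∀ᶠ y in 𝓝[openCone (firstCols Ξ)] 0,
        (((firstCols Ξ)⁻¹ *ᵥ x) i + ((firstCols Ξ)⁻¹ *ᵥ y) i ∈ Set.Ico (-(1 : ℝ) / 2) (1 / 2) ↔
          ((firstCols Ξ)⁻¹ *ᵥ x) i ∈ Set.Ico (-(1 : ℝ) / 2) (1 / 2)) := by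
      intro i
      refine Tendsto.eventually (f := fun y => ((firstCols Ξ)⁻¹ *ᵥ y) i) ?_
        (eventually_nhdsGT_add_mem_Ico_iff _ _ _)
      refine tendsto_nhdsWithin_iff.mpr ⟨?_, ?_⟩
      · have := (continuous_mulVec_apply (firstCols Ξ)⁻¹ i).tendsto 0
        simp only [mulVec_zero, Pi.zero_apply] at this
        exact this.mono_left nhdsWithin_le_nhds
      · filter_upwards [self_mem_nhdsWithin] with y hy using hy i
    filter_upwards [eventually_all.mpr h] with y hy
    rw [boxSplineAux_zero hΞ, boxSplineAux_zero hΞ, mulVec_add]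
    have : (firstCols Ξ)⁻¹ *ᵥ x + (firstCols Ξ)⁻¹ *ᵥ y ∈ centeredCube d ↔
        (firstCols Ξ)⁻¹ *ᵥ x ∈ centeredCube d := by
      simp only [centeredCube, Set.mem_univ_pi, Pi.add_apply, hy]
    by_cases hx : (firstCols Ξ)⁻¹ *ᵥ x ∈ centeredCube d
    · rw [Set.indicator_of_mem hx, Set.indicator_of_mem (this.mpr hx)]
    · rw [Set.indicator_of_notMem hx, Set.indicator_of_notMem (mt this.mp hx)]
  | succ n ih =>
    have hΞ' : (firstCols (dropLastCol Ξ)).det ≠ 0 := hΞ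
    obtain ⟨C, R, h⟩ := exists_bound_boxSplineAux hΞ'
    simp only [boxSplineAux_succ]
    refine intervalIntegral.tendsto_integral_filter_of_dominated_convergence (fun _ => C)
      (Eventually.of_forall fun y => ?_) (Eventually.of_forall fun y => ae_of_all _ fun t _ => (h _).1)
      intervalIntegrable_const (ae_of_all _ fun t _ => ?_)
    · exact ((measurable_boxSplineAux hΞ').comp (by fun_prop)).aestronglyMeasurable
    · have := ih (Ξ := dropLastCol Ξ) hΞ' (x - t • lastCol Ξ)
      simpa only [add_sub_right_comm, firstCols_dropLastCol] using this

theorem eq_of_tendsto_openCone_of_ae_eq {B : Matrix (Fin d) (Fin d) ℝ} (hB : B.det ≠ 0)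
    {f : (Fin d → ℝ) → ℝ} {L c : ℝ} (h : Tendsto f (𝓝[openCone B] 0) (𝓝 L))
    (hae : ∀ᵐ y, f y = c) : L = c := by
  by_contra hne
  obtain ⟨U, hU, h0, hUs⟩ := mem_nhdsWithin.mp (h.eventually_ne hne)
  have hcone : ∀ ε : ℝ, 0 < ε → ε • (B *ᵥ 1) ∈ openCone B := fun ε hε i => by
    rw [mulVec_smul, mulVec_mulVec, nonsing_inv_mul _ (isUnit_iff_ne_zero.mpr hB), one_mulVec]
    simpa using hε
  have hev : ∀ᶠ ε : ℝ in 𝓝[>] 0, ε • (B *ᵥ (1 : Fin d → ℝ)) ∈ U := by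
    have hc : Continuous fun ε : ℝ => ε • (B *ᵥ (1 : Fin d → ℝ)) := by fun_prop
    refine nhdsWithin_le_nhds (hc.continuousAt.preimage_mem_nhds ?_)
    simpa using hU.mem_nhds h0
  obtain ⟨ε, hε, hε0⟩ := (hev.and self_mem_nhdsWithin).exists
  obtain ⟨y, hy, hyc⟩ := (Measure.dense_of_ae hae).inter_open_nonempty _
    (hU.inter (isOpen_openCone B)) ⟨_, hε, hcone ε hε0⟩
  exact hUs hy hyc

end Cone

section Periodization

open Filter Topology

variable {d : ℕ}

/-- An integer vector, viewed as a real vector. -/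
def intVec (j : Fin d → ℤ) : Fin d → ℝ := fun i => (j i : ℝ)

theorem intVec_add (j k : Fin d → ℤ) : intVec (j + k) = intVec j + intVec k := by
  ext i
  simp [intVec]

theorem norm_expDot (w y : Fin d → ℝ) : ‖expDot w y‖ = 1 := by
  rw [expDot, mul_right_comm, ← Complex.ofReal_ofNat, ← Complex.ofReal_mul, ← Complex.ofReal_mul,
    Complex.norm_exp_ofReal_mul_I]

theorem expDot_intVec_zero (y : Fin d → ℝ) : expDot (intVec 0) y = 1 :=
  expDot_eq_one_of_int (z := 0) (by simp [intVec, dotProduct])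

theorem expDot_sub_intVec (k j : Fin d → ℤ) (y : Fin d → ℝ) :
    expDot (intVec k) (y - intVec j) = expDot (intVec k) y := by
  have h : expDot (intVec k) (intVec j) = 1 :=
    expDot_eq_one_of_int (z := k ⬝ᵥ j) (by simp [intVec, dotProduct])
  rw [← mul_one (expDot _ (y - intVec j)), ← h, ← expDot_add, sub_add_cancel]

theorem exists_finset_lt_norm_sub_intVec (R ρ : ℝ) :
    ∃ J : Finset (Fin d → ℤ), ∀ x : Fin d → ℝ, ‖x‖ ≤ ρ → ∀ j ∉ J, R < ‖x - intVec j‖ := by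
  refine ⟨Fintype.piFinset fun _ => Finset.Icc (-⌈R + ρ⌉) ⌈R + ρ⌉, fun x hx j hj => ?_⟩
  simp only [Fintype.mem_piFinset, not_forall, Finset.mem_Icc, ← abs_le, not_le] at hj
  obtain ⟨i, hi⟩ := hj
  have h1 : R + ρ < |(j i : ℝ)| := by
    refine (Int.le_ceil _).trans_lt ?_
    exact_mod_cast hi
  have h2 : |x i - j i| ≤ ‖x - intVec j‖ := norm_le_pi_norm (x - intVec j) i
  have h3 : |x i| ≤ ρ := (norm_le_pi_norm x i).trans hx
  have h4 := abs_sub_abs_le_abs_sub (j i : ℝ) (x i)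
  rw [abs_sub_comm] at h4
  linarith

theorem exists_unique_add_intVec_mem (y : Fin d → ℝ) :
    ∃! j : Fin d → ℤ, y + intVec j ∈ {x : Fin d → ℝ | ∀ i, x i ∈ Set.Ioc (0 : ℝ) (0 + 1)} := by
  refine ⟨fun i => 1 - ⌈y i⌉, fun i => ?_, fun j hj => funext fun i => ?_⟩
  · have h1 := Int.le_ceil (y i)
    have h2 := Int.ceil_lt_add_one (y i)
    simp only [Pi.add_apply, intVec, Set.mem_Ioc]
    push_cast
    constructor <;> linarith
  · have h : ⌈y i + (j i : ℝ)⌉ = 1 := by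
      rw [Int.ceil_eq_iff]
      have := hj i
      simp only [Pi.add_apply, intVec, Set.mem_Ioc] at this
      constructor <;> push_cast <;> linarith
    rw [Int.ceil_add_intCast] at h
    linarith

theorem volume_real_unitCube :
    volume.real {x : Fin d → ℝ | ∀ i, x i ∈ Set.Ioc (0 : ℝ) (0 + 1)} = 1 := by
  have : {x : Fin d → ℝ | ∀ i, x i ∈ Set.Ioc (0 : ℝ) (0 + 1)} =
      Set.univ.pi fun _ => Set.Ioc (0 : ℝ) (0 + 1) := by
    ext; simp
  rw [this, Measure.real, Real.volume_pi_Ioc]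
  simp

theorem setIntegral_unitCube_sum_sub_intVec {G : (Fin d → ℝ) → ℂ} (hG : Integrable G)
    {J : Finset (Fin d → ℤ)}
    (hJ : ∀ x ∈ {x : Fin d → ℝ | ∀ i, x i ∈ Set.Ioc (0 : ℝ) (0 + 1)}, ∀ j ∉ J,
      G (x - intVec j) = 0) :
    ∫ x in {x : Fin d → ℝ | ∀ i, x i ∈ Set.Ioc (0 : ℝ) (0 + 1)}, ∑ j ∈ J, G (x - intVec j) =
      ∫ y, G y := by
  set Q := {x : Fin d → ℝ | ∀ i, x i ∈ Set.Ioc (0 : ℝ) (0 + 1)}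
  have hQm : MeasurableSet Q := measurableSet_unitCube
  have hint : ∀ j, Integrable fun x => G (x - intVec j) := fun j => hG.comp_sub_right _
  have hG' : ∀ y, G y = ∑ j ∈ J, Q.indicator (fun x => G (x - intVec j)) (y + intVec j) := by
    intro y
    obtain ⟨j, hj, huniq⟩ := exists_unique_add_intVec_mem y
    rw [Finset.sum_eq_single j]
    · rw [Set.indicator_of_mem hj, add_sub_cancel_right]
    · intro k _ hk
      exact Set.indicator_of_notMem (fun h => hk (huniq k h)) _
    · intro hjJ
      rw [Set.indicator_of_mem hj, hJ _ hj j hjJ]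
  rw [integral_finsetSum _ fun j _ => (hint j).integrableOn, integral_congr_ae (ae_of_all _ hG'),
    integral_finsetSum]
  · refine Finset.sum_congr rfl fun j _ => ?_
    rw [integral_add_right_eq_self (fun y => Q.indicator (fun x => G (x - intVec j)) y),
      integral_indicator hQm]
  · exact fun j _ => ((hint j).indicator hQm).comp_add_right (intVec j)

theorem ae_finsum_sub_intVec_eq {N : (Fin d → ℝ) → ℝ} (hN : Measurable N) {C R : ℝ}
    (hC : ∀ x, ‖N x‖ ≤ C) (hR : ∀ x, R < ‖x‖ → N x = 0)
    (h0 : ∀ k : Fin d → ℤ, k ≠ 0 → ∫ y, expDot (intVec k) y * (N y : ℂ) = 0) :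
    ∀ᵐ y, ∑ᶠ j : Fin d → ℤ, N (y - intVec j) = (∫ y, (N y : ℂ)).re := by
  set Q := {x : Fin d → ℝ | ∀ i, x i ∈ Set.Ioc (0 : ℝ) (0 + 1)}
  have hQm : MeasurableSet Q := measurableSet_unitCube
  have hQ1 : ∀ x ∈ Q, ‖x‖ ≤ 1 := fun x hx => by
    refine (pi_norm_le_iff_of_nonneg zero_le_one).mpr fun i => ?_
    have := hx i
    rw [Real.norm_eq_abs, abs_le]
    constructor <;> linarith [this.1, this.2]
  obtain ⟨J, hJ⟩ := exists_finset_lt_norm_sub_intVec (d := d) R 1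
  have hfin : ∀ x ∈ Q, ∑ᶠ j, N (x - intVec j) = ∑ j ∈ J, N (x - intVec j) := fun x hx =>
    finsum_eq_sum_of_support_subset _ fun j hj => by
      by_contra hjJ
      exact hj (hR _ (hJ x (hQ1 x hx) j hjJ))
  have hNc : Measurable fun y => (N y : ℂ) := Complex.measurable_ofReal.comp hN
  have hint : ∀ k, Integrable fun y => expDot (intVec k) y * (N y : ℂ) := by
    intro k
    have hsupp : Function.support (fun y => expDot (intVec k) y * (N y : ℂ)) ⊆
        Metric.closedBall 0 R := by
      intro y hy
      by_contra hy'
      simp only [Metric.mem_closedBall, dist_zero_right, not_le] at hy'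
      exact hy (by simp [hR y hy'])
    rw [← integrableOn_iff_integrable_of_support_subset hsupp]
    refine Measure.integrableOn_of_bounded (M := C) measure_closedBall_lt_top.ne
      ((continuous_expDot _).measurable.mul hNc).aestronglyMeasurable (ae_of_all _ fun y => ?_)
    rw [norm_mul, norm_expDot, one_mul, Complex.norm_real]
    exact hC y
  have key : ∀ k, ∫ x in Q, expDot (intVec k) x * ∑ j ∈ J, (N (x - intVec j) : ℂ) =
      ∫ y, expDot (intVec k) y * (N y : ℂ) := by
    intro k
    rw [← setIntegral_unitCube_sum_sub_intVec (hint k) (J := J) fun x hx j hj => by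
      simp [hR _ (hJ x (hQ1 x hx) j hj)]]
    refine integral_congr_ae (ae_of_all _ fun x => ?_)
    simp only [Finset.mul_sum, expDot_sub_intVec]
  have hm : Measurable fun x => ∑ j ∈ J, (N (x - intVec j) : ℂ) :=
    Finset.measurable_sum _ fun j _ => hNc.comp (measurable_id.sub_const _)
  obtain ⟨c, hc⟩ := ae_eq_const_of_integral_exp_eq_zero hm (C := ∑ _j ∈ J, C)
    (fun x => (norm_sum_le _ _).trans (Finset.sum_le_sum fun j _ => by
      rw [Complex.norm_real]; exact hC _)) (fun k hk => (key k).trans (h0 k hk))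
  have hcI : ∫ y, (N y : ℂ) = c := by
    have h := key 0
    simp only [expDot_intVec_zero, one_mul] at h
    rw [← h, integral_congr_ae hc, setIntegral_const, volume_real_unitCube, one_smul]
  have hQae : ∀ᵐ x, x ∈ Q → ∑ᶠ j, N (x - intVec j) = c.re := by
    filter_upwards [(ae_restrict_iff' hQm).mp hc] with x hx hxQ
    rw [hfin x hxQ, ← hx hxQ]
    simp
  have hall : ∀ᵐ y, ∀ k : Fin d → ℤ, y + intVec k ∈ Q →
      ∑ᶠ j, N (y + intVec k - intVec j) = c.re :=
    ae_all_iff.mpr fun k =>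
      (measurePreserving_add_right volume (intVec k)).quasiMeasurePreserving.ae hQae
  rw [hcI]
  filter_upwards [hall] with y hy
  obtain ⟨k, hk, -⟩ := exists_unique_add_intVec_mem y
  rw [← hy k hk, ← finsum_comp_equiv (Equiv.addRight k)
    (f := fun j => N (y + intVec k - intVec j))]
  refine finsum_congr fun j => ?_
  rw [Equiv.coe_addRight, intVec_add, add_sub_add_right_eq_sub]

end Periodization

section Reproduction

open Filter Topology MvPolynomial Matrix

variable {d n : ℕ}

theorem finsum_eval_mul_boxSplineAux_sub_intVec_eq {Ξ : Matrix (Fin d) (Fin (d + n)) ℝ}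
    (hΞ : (firstCols Ξ).det ≠ 0) (hint : ∀ i j, ∃ z : ℤ, Ξ i j = z) {r : ℕ}
    (hr : ∀ k : Fin d → ℤ, k ≠ 0 →
      r ≤ (Finset.univ.filter fun j => intVec k ⬝ᵥ (fun i => Ξ i j) ≠ 0).card)
    {b : MvPolynomial (Fin d) ℝ} (hb : b ∈ degLT d r) (x : Fin d → ℝ) :
    ∑ᶠ j : Fin d → ℤ, eval (x - intVec j) b * boxSplineAux d n Ξ (x - intVec j) =
      (∫ y, ((eval y b : ℝ) : ℂ) * (boxSplineAux d n Ξ y : ℂ)).re := by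
  obtain ⟨C, R, h⟩ := exists_bound_boxSplineAux hΞ
  obtain ⟨D, hD⟩ := (isCompact_closedBall (0 : Fin d → ℝ) R).exists_bound_of_continuousOn
    (continuous_eval b).continuousOn
  have hR : ∀ y, R < ‖y‖ → eval y b * boxSplineAux d n Ξ y = 0 := fun y hy => by
    rw [(h y).2 hy, mul_zero]
  have hae := ae_finsum_sub_intVec_eq (N := fun y => eval y b * boxSplineAux d n Ξ y)
    (C := |D| * C) ((continuous_eval b).measurable.mul (measurable_boxSplineAux hΞ))
    (fun y => by
      have hC : 0 ≤ C := (norm_nonneg _).trans (h y).1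
      rcases le_or_gt ‖y‖ R with hy | hy
      · rw [norm_mul]
        exact mul_le_mul ((hD y (by simpa using hy)).trans (le_abs_self D)) (h y).1
          (norm_nonneg _) (abs_nonneg D)
      · rw [hR y hy, norm_zero]
        positivity) hR
    (fun k hk => by
      choose Z hZ using hint
      rw [← integral_eval_mul_expDot_mul_boxSplineAux hΞ (w := intVec k) (fun j =>
        ⟨∑ i, k i * Z i j, by simp [dotProduct, intVec, hZ]⟩) (degLT_mono (hr k hk) hb)]
      refine integral_congr_ae (ae_of_all _ fun y => ?_)
      push_cast
      ring)
  simp only [Complex.ofReal_mul] at hae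
  obtain ⟨J, hJ⟩ := exists_finset_lt_norm_sub_intVec (d := d) R (‖x‖ + 1)
  have hfin : ∀ y : Fin d → ℝ, ‖y‖ ≤ 1 →
      ∑ᶠ j, eval (x + y - intVec j) b * boxSplineAux d n Ξ (x + y - intVec j) =
        ∑ j ∈ J, eval (x - intVec j + y) b * boxSplineAux d n Ξ (x - intVec j + y) := by
    intro y hy
    simp only [sub_add_eq_add_sub]
    refine finsum_eq_sum_of_support_subset _ fun j hj => ?_
    by_contra hjJ
    exact hj (hR _ (hJ _ ((norm_add_le x y).trans (by gcongr)) j hjJ))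
  refine eq_of_tendsto_openCone_of_ae_eq hΞ (f := fun y =>
    ∑ᶠ j, eval (x + y - intVec j) b * boxSplineAux d n Ξ (x + y - intVec j)) ?_
    ((measurePreserving_add_left volume x).quasiMeasurePreserving.ae hae)
  have hx := hfin 0 (by simp)
  simp only [add_zero] at hx
  rw [hx]
  refine Tendsto.congr' (f₁ := fun y =>
    ∑ j ∈ J, eval (x - intVec j + y) b * boxSplineAux d n Ξ (x - intVec j + y)) ?_ ?_
  · filter_upwards [nhdsWithin_le_nhds (Metric.closedBall_mem_nhds (0 : Fin d → ℝ) one_pos)]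
      with y hy
    exact (hfin y (by simpa using hy)).symm
  · refine tendsto_finsetSum _ fun j _ => Tendsto.mul ?_ (tendsto_boxSplineAux_openCone hΞ _)
    have hc : Continuous fun y => eval (x - intVec j + y) b :=
      (continuous_eval b).comp (continuous_const.add continuous_id)
    simpa using (hc.tendsto 0).mono_left nhdsWithin_le_nhds

/-- The sum `∑ f(j) b(x - j) F(x - j)` over integer vectors `j`. -/
noncomputable def shiftSum (F : (Fin d → ℝ) → ℝ) (f b : MvPolynomial (Fin d) ℝ)
    (x : Fin d → ℝ) : ℝ :=
  ∑ᶠ j : Fin d → ℤ, eval (intVec j) f * (eval (x - intVec j) b * F (x - intVec j))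

theorem finite_support_mul_sub_intVec {F : (Fin d → ℝ) → ℝ} {R : ℝ}
    (hF : ∀ x, R < ‖x‖ → F x = 0) (a : (Fin d → ℤ) → ℝ) (x : Fin d → ℝ) :
    (Function.support fun j : Fin d → ℤ => a j * F (x - intVec j)).Finite := by
  obtain ⟨J, hJ⟩ := exists_finset_lt_norm_sub_intVec (d := d) R ‖x‖
  refine J.finite_toSet.subset fun j hj => ?_
  by_contra hjJ
  exact hj (by simp only [hF _ (hJ x le_rfl j hjJ), mul_zero])

theorem finite_support_shiftSum {F : (Fin d → ℝ) → ℝ} {R : ℝ}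
    (hF : ∀ x, R < ‖x‖ → F x = 0) (f b : MvPolynomial (Fin d) ℝ) (x : Fin d → ℝ) :
    (Function.support fun j : Fin d → ℤ =>
      eval (intVec j) f * (eval (x - intVec j) b * F (x - intVec j))).Finite :=
  finite_support_mul_sub_intVec (F := fun y => eval y b * F y)
    (fun y hy => by rw [hF y hy, mul_zero]) _ x

theorem shiftSum_add {F : (Fin d → ℝ) → ℝ} {R : ℝ} (hF : ∀ x, R < ‖x‖ → F x = 0)
    (f g b : MvPolynomial (Fin d) ℝ) (x : Fin d → ℝ) :
    shiftSum F (f + g) b x = shiftSum F f b x + shiftSum F g b x := by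
  rw [shiftSum, shiftSum, shiftSum, ← finsum_add_distrib (finite_support_shiftSum hF f b x)
    (finite_support_shiftSum hF g b x)]
  exact finsum_congr fun j => by rw [map_add, add_mul]

theorem shiftSum_smul (F : (Fin d → ℝ) → ℝ) (a : ℝ) (f b : MvPolynomial (Fin d) ℝ)
    (x : Fin d → ℝ) : shiftSum F (a • f) b x = a * shiftSum F f b x := by
  rw [shiftSum, shiftSum, ← smul_eq_mul, smul_finsum]
  exact finsum_congr fun j => by rw [smul_eval, smul_eq_mul, mul_assoc]

theorem shiftSum_mul_X {F : (Fin d → ℝ) → ℝ} {R : ℝ} (hF : ∀ x, R < ‖x‖ → F x = 0)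
    (f b : MvPolynomial (Fin d) ℝ) (i : Fin d) (x : Fin d → ℝ) :
    shiftSum F (f * X i) b x = x i * shiftSum F f b x - shiftSum F f (b * X i) x := by
  rw [eq_sub_iff_add_eq, shiftSum, shiftSum, shiftSum, ← smul_eq_mul (x i), smul_finsum,
    ← finsum_add_distrib (finite_support_shiftSum hF _ b x)
      (finite_support_shiftSum hF f (b * X i) x)]
  refine finsum_congr fun j => ?_
  simp only [map_mul, eval_X, Pi.sub_apply, smul_eq_mul]
  ring

theorem exists_shiftSum_eq_add {F : (Fin d → ℝ) → ℝ} {R : ℝ} (hF : ∀ x, R < ‖x‖ → F x = 0)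
    {r : ℕ} (hper : ∀ b ∈ degLT d r, ∀ x, shiftSum F 1 b x = shiftSum F 1 b 0)
    (h1 : 0 < r → shiftSum F 1 1 0 = 1) {k : ℕ} (hk : k ≤ r) {f : MvPolynomial (Fin d) ℝ}
    (hf : f ∈ degLT d k) :
    ∃ g ∈ degLT d (k - 1), ∀ x, shiftSum F f 1 x = eval x f + eval x g := by
  refine degLT_induction
    (P := fun f => ∃ g ∈ degLT d (k - 1), ∀ x, shiftSum F f 1 x = eval x f + eval x g)
    ⟨0, zero_mem _, fun x => by simp [shiftSum]⟩ ?_ ?_ (fun s hs => ?_) hf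
  · rintro p q ⟨g, hg, h⟩ ⟨g', hg', h'⟩
    refine ⟨g + g', add_mem hg hg', fun x => ?_⟩
    rw [shiftSum_add hF, h, h', map_add, map_add]
    ring
  · rintro a p ⟨g, hg, h⟩
    refine ⟨a • g, Submodule.smul_mem _ _ hg, fun x => ?_⟩
    rw [shiftSum_smul, h, smul_eval, smul_eval]
    ring
  · obtain ⟨-, h⟩ := monomial_degree_induction (P := fun n f => f ∈ degLT d (n + 1) ∧
      ∀ l, ∀ b ∈ degLT d l, n + l ≤ r → ∃ g ∈ degLT d n,
        ∀ x, shiftSum F f b x = shiftSum F 1 b 0 * eval x f + eval x g)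
      ⟨by simpa using C_mem_degLT (d := d) 1 0, fun l b hb hl => ⟨0, zero_mem _, fun x => by
        rw [hper b (degLT_mono (by omega) hb) x]; simp⟩⟩ (by
        rintro n f i ⟨hf, hfb⟩
        refine ⟨mul_X_mem_degLT hf i, fun l b hb hl => ?_⟩
        obtain ⟨g, hg, h⟩ := hfb l b hb (by omega)
        obtain ⟨g', hg', h'⟩ := hfb (l + 1) (b * X i)
          (mul_X_mem_degLT hb i) (by omega)
        refine ⟨g * X i - (shiftSum F 1 (b * X i) 0 • f + g'), sub_mem (mul_X_mem_degLT hg i)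
          (add_mem (Submodule.smul_mem _ _ hf) (degLT_mono (Nat.le_succ n) hg')), fun x => ?_⟩
        rw [shiftSum_mul_X hF, h, h']
        simp only [map_mul, map_sub, map_add, eval_X, smul_eval]
        ring) s
    obtain ⟨g, hg, h⟩ := h 1 1 (by simpa using C_mem_degLT (d := d) 1 0) (by omega)
    exact ⟨g, degLT_mono (by omega) hg, fun x => by rw [h, h1 (by omega), one_mul]⟩

theorem exists_shiftSum_eq {F : (Fin d → ℝ) → ℝ} {R : ℝ} (hF : ∀ x, R < ‖x‖ → F x = 0)
    {r : ℕ} (hper : ∀ b ∈ degLT d r, ∀ x, shiftSum F 1 b x = shiftSum F 1 b 0)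
    (h1 : 0 < r → shiftSum F 1 1 0 = 1) {k : ℕ} (hk : k ≤ r) {f : MvPolynomial (Fin d) ℝ}
    (hf : f ∈ degLT d k) : ∃ c, ∀ x, shiftSum F c 1 x = eval x f := by
  induction k generalizing f with
  | zero => exact ⟨0, fun x => by simp [shiftSum, eq_zero_of_mem_degLT_zero hf]⟩
  | succ k ih =>
    obtain ⟨g, hg, h⟩ := exists_shiftSum_eq_add hF hper h1 hk hf
    obtain ⟨c, hc⟩ := ih (by omega) hg
    refine ⟨f + (-1 : ℝ) • c, fun x => ?_⟩
    rw [shiftSum_add hF, shiftSum_smul, h, hc]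
    ring

theorem exists_finsum_mul_boxSplineAux_eq {Ξ : Matrix (Fin d) (Fin (d + n)) ℝ}
    (hΞ : (firstCols Ξ).det ≠ 0) (hint : ∀ i j, ∃ z : ℤ, Ξ i j = z) {r : ℕ}
    (hr : ∀ k : Fin d → ℤ, k ≠ 0 →
      r ≤ (Finset.univ.filter fun j => intVec k ⬝ᵥ (fun i => Ξ i j) ≠ 0).card)
    {p : MvPolynomial (Fin d) ℝ} (hp : p ∈ degLT d r) :
    ∃ c : (Fin d → ℤ) → ℝ, ∀ x,
      (Function.support fun j : Fin d → ℤ => c j * boxSplineAux d n Ξ (x - intVec j)).Finite ∧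
      ∑ᶠ j : Fin d → ℤ, c j * boxSplineAux d n Ξ (x - intVec j) = eval x p := by
  obtain ⟨C, R, h⟩ := exists_bound_boxSplineAux hΞ
  have hF := fun x => (h x).2
  have hconst : ∀ b ∈ degLT d r, ∀ x, shiftSum (boxSplineAux d n Ξ) 1 b x =
      (∫ y, ((eval y b : ℝ) : ℂ) * (boxSplineAux d n Ξ y : ℂ)).re := fun b hb x => by
    rw [← finsum_eval_mul_boxSplineAux_sub_intVec_eq hΞ hint hr hb x, shiftSum]
    simp only [map_one, one_mul]
  obtain ⟨c, hc⟩ := exists_shiftSum_eq hF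
    (fun b hb x => (hconst b hb x).trans (hconst b hb 0).symm)
    (fun hr0 => by
      rw [hconst 1 (degLT_mono hr0 (by simpa using C_mem_degLT (d := d) 1 0))]
      simp only [map_one, Complex.ofReal_one, integral_boxSplineAux hΞ, Complex.one_re])
    le_rfl hp
  refine ⟨fun j => eval (intVec j) c, fun x => ⟨finite_support_mul_sub_intVec hF _ x, ?_⟩⟩
  rw [← hc, shiftSum]
  simp only [map_one, one_mul]

theorem boxSplineR_le_card_dotProduct_ne_zero {m : ℕ} (Ξ : Matrix (Fin d) (Fin m) ℝ)
    {w : Fin d → ℝ} (hw : w ≠ 0) :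
    boxSplineR Ξ ≤ (Finset.univ.filter fun j => w ⬝ᵥ (fun i => Ξ i j) ≠ 0).card := by
  refine Nat.sInf_le ⟨_, rfl, fun htop => hw ?_⟩
  have hle : Submodule.span ℝ ((fun j => fun i => Ξ i j) ''
      (↑(Finset.univ.filter fun j => w ⬝ᵥ (fun i => Ξ i j) ≠ 0)ᶜ : Set (Fin m))) ≤
      LinearMap.ker (dotProductBilin ℝ ℝ w) := by
    rw [Submodule.span_le]
    rintro _ ⟨j, hj, rfl⟩
    simpa using hj
  rw [htop, top_le_iff] at hle
  refine dotProduct_eq_zero w fun v => ?_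
  have : v ∈ LinearMap.ker (dotProductBilin ℝ ℝ w) := hle ▸ Submodule.mem_top
  simpa using this

end Reproduction

/-- the span of the integer shifts of the centered box spline of an
integer direction matrix reproduces all polynomials of total degree at most
`r(Ξ) - 1`. -/
theorem boxSpline_polynomial_reproduction {d m : ℕ} (hd : 1 ≤ d) (hdm : d ≤ m)
    (Ξ : Matrix (Fin d) (Fin m) ℤ)
    (hΞ : LinearIndependent ℝ fun j : Fin d => fun i =>
      (Ξ.map (Int.cast : ℤ → ℝ)) i (Fin.castLE hdm j))
    (p : MvPolynomial (Fin d) ℝ)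
    (hp : p.totalDegree ≤ boxSplineR (Ξ.map (Int.cast : ℤ → ℝ)) - 1) :
    ∃ c : (Fin d → ℤ) → ℝ, ∀ x : Fin d → ℝ,
      (Function.support fun j : Fin d → ℤ =>
        c j * boxSpline hdm (Ξ.map (Int.cast : ℤ → ℝ)) (x - fun i => (j i : ℝ))).Finite ∧
      ∑ᶠ j : Fin d → ℤ,
        c j * boxSpline hdm (Ξ.map (Int.cast : ℤ → ℝ)) (x - fun i => (j i : ℝ)) =
          MvPolynomial.eval x p := by
  set A : Matrix (Fin d) (Fin m) ℝ := Ξ.map (Int.cast : ℤ → ℝ)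
  have hcount : ∀ k : Fin d → ℤ, k ≠ 0 → p.totalDegree + 1 ≤
      (Finset.univ.filter fun j => dotProduct (intVec k) (fun i => A i j) ≠ 0).card := by
    intro k hk
    have hw : intVec k ≠ 0 := fun h => hk (funext fun i => by simpa [intVec] using congrFun h i)
    have hle := boxSplineR_le_card_dotProduct_ne_zero A hw
    suffices 0 < (Finset.univ.filter fun j => dotProduct (intVec k) (fun i => A i j) ≠ 0).card by
      omega
    rw [Finset.card_pos]
    by_contra hempty
    rw [Finset.not_nonempty_iff_eq_empty, Finset.filter_eq_empty_iff] at hempty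
    refine hw (Matrix.eq_zero_of_vecMul_eq_zero
      (M := Matrix.of fun i j : Fin d => A i (Fin.castLE hdm j)) ?_ (funext fun j => ?_))
    · exact (Matrix.linearIndependent_cols_iff_isUnit.mp hΞ).map Matrix.detMonoidHom |>.ne_zero
    · exact not_not.mp (hempty (Finset.mem_univ (Fin.castLE hdm j)))
  refine exists_finsum_mul_boxSplineAux_eq (n := m - d)
    (Ξ := fun i j => A i (Fin.cast (Nat.add_sub_cancel' hdm) j)) ?_
    (fun i j => ⟨_, Matrix.map_apply ..⟩) (fun k hk => (hcount k hk).trans ?_)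
    (mem_degLT_of_totalDegree (Nat.lt_succ_self _))
  · exact (Matrix.linearIndependent_cols_iff_isUnit.mp hΞ).map Matrix.detMonoidHom |>.ne_zero
  · rw [Finset.card_filter, Finset.card_filter]
    exact (Fintype.sum_equiv (finCongr (Nat.add_sub_cancel' hdm)) _ _ fun _ => rfl).ge
end

section
/- Let d ≤ m and let Ξ be an integer d×m matrix whose first d columns are linearly independent. Then for Lebesgue-almost every x ∈ ℝ^d, the set {j ∈ ℤ^d : M_Ξ(x − j) ≠ 0} is finite and its cardinality equals the d-dimensional Lebesgue volume of the zonotope Ξ[−1/2,1/2]^m = {∑_{i=1}^m t_i ξ_i : t_i ∈ [−1/2,1/2]}. -/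
open MeasureTheory

section Zonotope

variable {ι κ E F : Type*} [Fintype ι] [Fintype κ]

/-- The zonotope `{∑ i, t i • v i | t i ∈ [l, u]}` generated by a finite family of vectors. -/
def zonotope [AddCommGroup E] [Module ℝ E] (l u : ℝ) (v : ι → E) : Set E :=
  {y | ∃ t : ι → ℝ, (∀ i, t i ∈ Set.Icc l u) ∧ y = ∑ i, t i • v i}

theorem zonotope_comp_equiv [AddCommGroup E] [Module ℝ E] (l u : ℝ) (v : ι → E) (e : κ ≃ ι) :
    zonotope l u (v ∘ e) = zonotope l u v := by
  ext y
  constructor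
  · rintro ⟨t, ht, rfl⟩
    refine ⟨t ∘ e.symm, fun i => ht _, ?_⟩
    rw [← e.sum_comp]
    simp
  · rintro ⟨t, ht, rfl⟩
    exact ⟨t ∘ e, fun i => ht _, (e.sum_comp fun i => t i • v i).symm⟩

theorem mem_zonotope_succ [AddCommGroup E] [Module ℝ E] {n : ℕ} {l u : ℝ} {v : Fin (n + 1) → E}
    {y : E} : y ∈ zonotope l u v ↔
      ∃ s ∈ Set.Icc l u, y - s • v (Fin.last n) ∈ zonotope l u fun i => v (Fin.castSucc i) := by
  constructor
  · rintro ⟨t, ht, rfl⟩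
    refine ⟨t (Fin.last n), ht _, fun i => t (Fin.castSucc i), fun i => ht _, ?_⟩
    rw [Fin.sum_univ_castSucc, add_sub_cancel_right]
  · rintro ⟨s, hs, t, ht, h⟩
    refine ⟨Fin.snoc t s, fun i => ?_, ?_⟩
    · refine Fin.lastCases ?_ (fun j => ?_) i
      · simpa using hs
      · simpa using ht j
    · rw [Fin.sum_univ_castSucc]
      simp [← h]

theorem image_zonotope [AddCommGroup E] [Module ℝ E] [AddCommGroup F] [Module ℝ F]
    (l u : ℝ) (v : ι → E) (f : E →ₗ[ℝ] F) :
    f '' zonotope l u v = zonotope l u fun i => f (v i) := by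
  ext y
  constructor
  · rintro ⟨_, ⟨t, ht, rfl⟩, rfl⟩
    exact ⟨t, ht, by simp⟩
  · rintro ⟨t, ht, rfl⟩
    exact ⟨_, ⟨t, ht, rfl⟩, by simp⟩

theorem zonotope_eq_image [AddCommGroup E] [Module ℝ E] (l u : ℝ) (v : ι → E) :
    zonotope l u v = Fintype.linearCombination ℝ v '' Set.pi Set.univ fun _ => Set.Icc l u := by
  ext y
  simp [zonotope, Fintype.linearCombination_apply, eq_comm, forall_and, Pi.le_def]

theorem convex_zonotope [AddCommGroup E] [Module ℝ E] (l u : ℝ) (v : ι → E) :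
    Convex ℝ (zonotope l u v) := by
  rw [zonotope_eq_image]
  exact (convex_pi fun _ _ => convex_Icc l u).linear_image _

theorem isCompact_zonotope [NormedAddCommGroup E] [NormedSpace ℝ E] (l u : ℝ) (v : ι → E) :
    IsCompact (zonotope l u v) := by
  rw [zonotope_eq_image]
  exact (isCompact_univ_pi fun _ => isCompact_Icc).image
    (LinearMap.continuous_of_finiteDimensional _)

theorem zonotope_add [AddCommGroup E] [Module ℝ E] (l u a : ℝ) (v : ι → E) (y : E) :
    y ∈ zonotope (l + a) (u + a) v ↔ y - a • ∑ i, v i ∈ zonotope l u v := by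
  constructor
  · rintro ⟨t, ht, rfl⟩
    refine ⟨fun i => t i - a, fun i => ?_, ?_⟩
    · have := ht i
      simp only [Set.mem_Icc] at *
      constructor <;> linarith
    · simp [sub_smul, Finset.sum_sub_distrib, Finset.smul_sum]
  · rintro ⟨t, ht, h⟩
    refine ⟨fun i => t i + a, fun i => ?_, ?_⟩
    · have := ht i
      simp only [Set.mem_Icc] at *
      constructor <;> linarith
    · rw [sub_eq_iff_eq_add] at h
      simp [add_smul, Finset.sum_add_distrib, Finset.smul_sum, h]

end Zonotope

section Count

variable {E F : Type*} [NormedAddCommGroup E] [NormedSpace ℝ E] [AddCommGroup F] [Module ℝ F]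

/-- Along a line of direction `ξ` meeting a compact convex set `Z`, the points of
`Z + [0, 1] ξ` outside `Z` form a half-open segment congruent to `[0, 1) ξ`. -/
theorem exists_Ico_of_convex_isCompact {Z : Set E} (hc : Convex ℝ Z) (hZ : IsCompact Z) {ξ : E}
    (hξ : ξ ≠ 0) {y : E} (hy : ∃ s : ℝ, y - s • ξ ∈ Z) :
    ∃ c : ℝ, ∀ s : ℝ, ((∃ τ ∈ Set.Icc (0 : ℝ) 1, y - s • ξ - τ • ξ ∈ Z) ∧ y - s • ξ ∉ Z) ↔
      s ∈ Set.Ico c (c + 1) := by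
  set f : ℝ → E := fun s => y - s • ξ with hf
  set T : Set ℝ := f ⁻¹' Z with hT
  have hemb : Topology.IsClosedEmbedding f :=
    (Homeomorph.subLeft y).isClosedEmbedding.comp (isClosedEmbedding_smul_left hξ)
  have hTc : IsCompact T := hemb.isCompact_preimage hZ
  have hTconv : Convex ℝ T := by
    intro a ha b hb p q hp hq hpq
    have := hc ha hb hp hq hpq
    simp only [hT, Set.mem_preimage, hf] at this ⊢
    convert this using 1
    obtain rfl : p = 1 - q := by linarith
    simp only [smul_eq_mul]
    module
  have hTi : T = Set.Icc (sInf T) (sSup T) :=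
    eq_Icc_of_connected_compact ⟨hy, hTconv.isPreconnected⟩ hTc
  have hab : sInf T ≤ sSup T := by
    obtain ⟨s, hs⟩ := hy
    have hs : s ∈ T := hs
    rw [hTi] at hs
    exact hs.1.trans hs.2
  have key : ∀ s : ℝ, y - s • ξ ∈ Z ↔ s ∈ Set.Icc (sInf T) (sSup T) := fun s => by
    rw [← hTi]; rfl
  refine ⟨sInf T - 1, fun s => ?_⟩
  have h2 : ∀ τ : ℝ, y - s • ξ - τ • ξ = y - (s + τ) • ξ := fun τ => by module
  simp only [h2, key, Set.mem_Icc, Set.mem_Ico]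
  constructor
  · rintro ⟨⟨τ, hτ, h3⟩, h4⟩
    constructor
    · linarith
    · by_contra h5
      exact h4 ⟨by linarith, by linarith⟩
  · rintro ⟨h3, h4⟩
    refine ⟨⟨sInf T - s, ⟨by linarith, by linarith⟩, by linarith, by linarith⟩, fun h => ?_⟩
    linarith [h.1]

/-- Counting the points `p` of a subgroup with `x - p ∈ Z + [0, 1] ξ`: those with `x - p ∉ Z` are
counted by the image of the subgroup in the quotient by the line spanned by `ξ`. -/
theorem encard_add_segment {Z Z' : Set E} (hc : Convex ℝ Z) (hZ : IsCompact Z) {ξ : E}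
    (hξ : ξ ≠ 0) (hZ' : ∀ y, y ∈ Z' ↔ ∃ τ ∈ Set.Icc (0 : ℝ) 1, y - τ • ξ ∈ Z)
    (π : E →ₗ[ℝ] F) (hπ : LinearMap.ker π = Submodule.span ℝ {ξ}) (L : AddSubgroup E)
    (hL : ξ ∈ L) (x : E) :
    {p | p ∈ L ∧ x - p ∈ Z'}.encard = {p | p ∈ L ∧ x - p ∈ Z}.encard +
      {q | q ∈ L.map π.toAddMonoidHom ∧ π x - q ∈ π '' Z}.encard *
        {ρ : ℝ | ρ ∈ Set.Ico (0 : ℝ) 1 ∧ ρ • ξ ∈ L}.encard := by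
  have hπξ : π ξ = 0 := by
    have : ξ ∈ LinearMap.ker π := hπ ▸ Submodule.mem_span_singleton_self ξ
    exact this
  have hker : ∀ y, π y = 0 → ∃ u : ℝ, u • ξ = y := fun y hy => by
    have : y ∈ LinearMap.ker π := hy
    rw [hπ] at this
    exact Submodule.mem_span_singleton.1 this
  set Q := {q | q ∈ L.map π.toAddMonoidHom ∧ π x - q ∈ π '' Z} with hQ
  set R := {ρ : ℝ | ρ ∈ Set.Ico (0 : ℝ) 1 ∧ ρ • ξ ∈ L} with hR
  set D := {p | p ∈ L ∧ x - p ∈ Z' ∧ x - p ∉ Z} with hD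
  have hsplit : {p | p ∈ L ∧ x - p ∈ Z'} = {p | p ∈ L ∧ x - p ∈ Z} ∪ D := by
    ext p
    simp only [hD, Set.mem_union, Set.mem_ofPred_eq]
    have : x - p ∈ Z → x - p ∈ Z' := fun h => (hZ' _).2 ⟨0, by simp, by simpa using h⟩
    tauto
  have hdisj : Disjoint {p | p ∈ L ∧ x - p ∈ Z} D :=
    Set.disjoint_left.2 fun p h1 h2 => h2.2.2 h1.2
  rw [hsplit, Set.encard_union_eq hdisj, ← Set.encard_prod]
  congr 1
  have hex : ∀ q : F, ∃ p : E, ∃ c : ℝ, q ∈ Q → p ∈ L ∧ π p = q ∧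
      ∀ s : ℝ, (x - p - s • ξ ∈ Z' ∧ x - p - s • ξ ∉ Z) ↔ s ∈ Set.Ico c (c + 1) := by
    intro q
    by_cases hq : q ∈ Q
    · obtain ⟨⟨p, hp, rfl⟩, z, hz, hzx⟩ := hq
      obtain ⟨u, hu⟩ := hker (x - p - z) (by
        simp only [map_sub, hzx, LinearMap.toAddMonoidHom_coe, sub_self])
      obtain ⟨c, hc'⟩ := exists_Ico_of_convex_isCompact hc hZ hξ (y := x - p)
        ⟨u, by rw [hu]; simpa using hz⟩
      refine ⟨p, c, fun _ => ⟨hp, rfl, fun s => ?_⟩⟩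
      rw [hZ', hc']
    · exact ⟨0, 0, fun h => absurd h hq⟩
  choose P c hPc using hex
  let g : F × ℝ → E := fun a => P a.1 + toIcoMod (zero_lt_one' ℝ) (c a.1) a.2 • ξ
  have hmodL : ∀ a b : ℝ, toIcoMod (zero_lt_one' ℝ) a b • ξ ∈ L ↔ b • ξ ∈ L := by
    intro a b
    have h := toIcoMod_add_toIcoDiv_zsmul (zero_lt_one' ℝ) a b
    have h2 : b • ξ = toIcoMod (zero_lt_one' ℝ) a b • ξ + toIcoDiv (zero_lt_one' ℝ) a b • ξ := by
      conv_lhs => rw [← h]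
      rw [add_smul, smul_assoc, one_smul]
    rw [h2, L.add_mem_cancel_right (L.zsmul_mem hL _)]
  have himage : g '' (Q ×ˢ R) = D := by
    ext p
    constructor
    · rintro ⟨⟨q, ρ⟩, ⟨hq, hρ⟩, rfl⟩
      obtain ⟨h1, h2, h3⟩ := hPc q hq
      refine ⟨L.add_mem h1 ((hmodL _ _).2 hρ.2), ?_⟩
      simp only [g, ← sub_sub]
      exact (h3 _).2 (toIcoMod_mem_Ico _ _ _)
    · rintro ⟨hp, hp1, hp2⟩
      have hq : π p ∈ Q := by
        refine ⟨⟨p, hp, rfl⟩, ?_⟩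
        obtain ⟨τ, -, h⟩ := (hZ' _).1 hp1
        exact ⟨_, h, by simp [hπξ]⟩
      obtain ⟨h1, h2, h3⟩ := hPc _ hq
      obtain ⟨u, hu⟩ := hker (p - P (π p)) (by rw [map_sub, h2, sub_self])
      have hpu : x - p = x - P (π p) - u • ξ := by rw [hu]; abel
      have huL : u • ξ ∈ L := hu ▸ L.sub_mem hp h1
      rw [hpu] at hp1 hp2
      have hIco := (h3 u).1 ⟨hp1, hp2⟩
      refine ⟨(π p, toIcoMod (zero_lt_one' ℝ) 0 u), ⟨hq, ?_, (hmodL _ _).2 huL⟩, ?_⟩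
      · simpa using toIcoMod_mem_Ico (zero_lt_one' ℝ) 0 u
      · simp only [g, toIcoMod_toIcoMod, (toIcoMod_eq_self (zero_lt_one' ℝ)).2 hIco, hu]
        abel
  rw [← himage]
  refine Set.InjOn.encard_image ?_
  rintro ⟨q, ρ⟩ ⟨hq, hρ⟩ ⟨q', ρ'⟩ ⟨hq', hρ'⟩ h
  have hqq : q = q' := by
    have := congrArg π h
    simpa [g, hπξ, (hPc q hq).2.1, (hPc q' hq').2.1] using this
  subst hqq
  have h1 : toIcoMod (zero_lt_one' ℝ) (c q) ρ = toIcoMod (zero_lt_one' ℝ) (c q) ρ' :=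
    smul_left_injective ℝ hξ (by simpa [g] using h)
  have h2 := congrArg (toIcoMod (zero_lt_one' ℝ) 0) h1
  rw [toIcoMod_toIcoMod, toIcoMod_toIcoMod,
    (toIcoMod_eq_self (zero_lt_one' ℝ)).2 (by simpa using hρ.1),
    (toIcoMod_eq_self (zero_lt_one' ℝ)).2 (by simpa using hρ'.1)] at h2
  rw [h2]

end Count

/-- The preimage of an almost sure property under a surjective linear map is almost sure. -/
theorem ae_comp_linearMap {k l : ℕ} (π : (Fin k → ℝ) →ₗ[ℝ] (Fin l → ℝ))
    (hπ : Function.Surjective π) {P : (Fin l → ℝ) → Prop} (h : ∀ᵐ y, P y) : ∀ᵐ x, P (π x) := by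
  obtain ⟨s, hs, hsm, hs0⟩ := exists_measurable_superset_of_null (ae_iff.1 h)
  have h1 : ∀ᵐ y : Fin l → ℝ, y ∈ sᶜ := by
    rw [ae_iff]
    simpa using hs0
  filter_upwards [(ae_comp_linearMap_mem_iff π volume volume hπ hsm.compl).2 h1] with x hx
  by_contra h2
  exact hx (hs h2)

/-- For a countable subgroup `L` containing the generators of a zonotope `Z`, the number of
`L`-translates of `Z` covering a point is almost everywhere constant. -/
theorem exists_ae_encard_eq (n : ℕ) : ∀ (k : ℕ) (L : AddSubgroup (Fin k → ℝ)) [Countable L]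
    (v : Fin n → Fin k → ℝ), (∀ i, v i ∈ L) →
    ∃ c : ℕ∞, ∀ᵐ x : Fin k → ℝ, {p | p ∈ L ∧ x - p ∈ zonotope 0 1 v}.encard = c := by
  induction n with
  | zero =>
    intro k L _ v _
    have hz : zonotope 0 1 v = {0} := by
      ext y
      simp [zonotope]
    rcases Nat.eq_zero_or_pos k with rfl | hk
    · exact ⟨_, Filter.Eventually.of_forall fun x => by rw [Subsingleton.elim x 0]⟩
    · have : Nonempty (Fin k) := ⟨⟨0, hk⟩⟩
      refine ⟨0, ?_⟩
      have hL : volume (L : Set (Fin k → ℝ)) = 0 :=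
        (Set.countable_coe_iff.1 ‹_›).measure_zero _
      filter_upwards [measure_eq_zero_iff_ae_notMem.1 hL] with x hx
      rw [Set.encard_eq_zero, Set.eq_empty_iff_forall_notMem]
      rintro p ⟨hp, hxp⟩
      rw [hz, Set.mem_singleton_iff, sub_eq_zero] at hxp
      exact hx (hxp ▸ hp)
  | succ n ih =>
    intro k L _ v hv
    set ξ := v (Fin.last n) with hξdef
    set w : Fin n → Fin k → ℝ := fun i => v (Fin.castSucc i) with hw
    obtain ⟨c₁, hc₁⟩ := ih k L w fun i => hv _
    by_cases hξ : ξ = 0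
    · refine ⟨c₁, ?_⟩
      have : zonotope 0 1 v = zonotope 0 1 w := by
        ext y
        rw [mem_zonotope_succ, ← hξdef, hξ]
        simp only [smul_zero, sub_zero]
        exact ⟨fun ⟨_, _, h⟩ => h, fun h => ⟨0, by simp, h⟩⟩
      rwa [this]
    · let W := Submodule.span ℝ {ξ}
      let e := (Module.finBasis ℝ ((Fin k → ℝ) ⧸ W)).equivFun
      let π := e.toLinearMap ∘ₗ W.mkQ
      have hker : LinearMap.ker π = W := by
        rw [LinearMap.ker_comp, LinearEquiv.ker, Submodule.comap_bot, Submodule.ker_mkQ]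
      have hsurj : Function.Surjective π := e.surjective.comp W.mkQ_surjective
      have : Countable (L.map π.toAddMonoidHom) := by
        have := (Set.countable_coe_iff.1 ‹Countable L›).image π
        exact this.to_subtype
      obtain ⟨c₂, hc₂⟩ := ih _ (L.map π.toAddMonoidHom) (fun i => π (w i))
        fun i => ⟨_, hv _, rfl⟩
      refine ⟨c₁ + c₂ * {ρ : ℝ | ρ ∈ Set.Ico (0 : ℝ) 1 ∧ ρ • ξ ∈ L}.encard, ?_⟩
      filter_upwards [hc₁, ae_comp_linearMap π hsurj hc₂] with x h1 h2
      rw [encard_add_segment (convex_zonotope 0 1 w) (isCompact_zonotope 0 1 w) hξ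
        (fun y => mem_zonotope_succ) π hker L (hv _) x, h1, image_zonotope, h2]

/-- An interior point of a set is a proper contraction of some point of the set. -/
theorem exists_smul_eq_of_mem_interior {E : Type*} [NormedAddCommGroup E] [NormedSpace ℝ E]
    {Z : Set E} {x : E} (hx : x ∈ interior Z) :
    ∃ a : ℝ, 0 < a ∧ a < 1 ∧ ∃ z ∈ Z, x = a • z := by
  have hcont : Filter.Tendsto (fun r : ℝ => r • x) (nhds 1) (nhds x) := by
    have : Continuous fun r : ℝ => r • x := by fun_prop
    simpa using this.tendsto 1
  have hmem : ∀ᶠ r : ℝ in nhdsWithin 1 (Set.Ioi 1), r • x ∈ Z :=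
    (hcont.eventually (mem_interior_iff_mem_nhds.1 hx)).filter_mono nhdsWithin_le_nhds
  obtain ⟨r, hr, hr1⟩ := (hmem.and self_mem_nhdsWithin).exists
  have hr1 : 1 < r := hr1
  have hr0 : 0 < r := by linarith
  exact ⟨r⁻¹, inv_pos.2 hr0, inv_lt_one_of_one_lt₀ hr1, _, hr, by
    rw [smul_smul, inv_mul_cancel₀ hr0.ne', one_smul]⟩

theorem smul_mem_Ioo_of_mem_Icc {a t : ℝ} (ha0 : 0 < a) (ha1 : a < 1)
    (ht : t ∈ Set.Icc (-(1 : ℝ) / 2) (1 / 2)) : a * t ∈ Set.Ioo (-(1 : ℝ) / 2) (1 / 2) := by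
  obtain ⟨h1, h2⟩ := ht
  constructor <;> nlinarith

/-- The box spline is measurable and bounded, is supported in its zonotope, and is positive in
the interior of the zonotope. -/
theorem boxSplineAux_properties (d : ℕ) : ∀ (n : ℕ) (Ξ : Matrix (Fin d) (Fin (d + n)) ℝ),
    (LinearIndependent ℝ fun j : Fin d => fun i => Ξ i (Fin.castAdd n j)) →
    StronglyMeasurable (boxSplineAux d n Ξ) ∧
    (∃ C : ℝ, ∀ x, 0 ≤ boxSplineAux d n Ξ x ∧ boxSplineAux d n Ξ x ≤ C) ∧
    (∀ x, boxSplineAux d n Ξ x ≠ 0 → x ∈ zonotope (-(1 : ℝ) / 2) (1 / 2) fun j i => Ξ i j) ∧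
    (∀ x ∈ interior (zonotope (-(1 : ℝ) / 2) (1 / 2) fun j i => Ξ i j),
      0 < boxSplineAux d n Ξ x) ∧
    (0 : Fin d → ℝ) ∈ interior (zonotope (-(1 : ℝ) / 2) (1 / 2) fun j i => Ξ i j) := by
  intro n
  induction n with
  | zero =>
    intro Ξ hΞ
    set A : Matrix (Fin d) (Fin d) ℝ :=
      Matrix.of fun i j => Ξ i (Fin.cast (Nat.add_zero d).symm j) with hA
    have hAu : IsUnit A := Matrix.linearIndependent_cols_iff_isUnit.1 hΞ
    have hdet : IsUnit A.det := (Matrix.isUnit_iff_isUnit_det A).1 hAu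
    set S : Set (Fin d → ℝ) := {y | ∃ t : Fin d → ℝ,
      (∀ i, t i ∈ Set.Ico (-(1 : ℝ) / 2) (1 / 2)) ∧ y = A.mulVec t} with hS
    have hM : boxSplineAux d 0 Ξ = S.indicator fun _ => |A.det|⁻¹ := rfl
    have hinv : ∀ y t : Fin d → ℝ, y = A.mulVec t ↔ A⁻¹.mulVec y = t := by
      intro y t
      constructor
      · rintro rfl
        rw [Matrix.mulVec_mulVec, Matrix.nonsing_inv_mul _ hdet, Matrix.one_mulVec]
      · rintro rfl
        rw [Matrix.mulVec_mulVec, Matrix.mul_nonsing_inv _ hdet, Matrix.one_mulVec]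
    have hcont : Continuous fun y : Fin d → ℝ => A⁻¹.mulVec y :=
      Continuous.matrix_mulVec continuous_const continuous_id
    have hSpre : S = (fun y => A⁻¹.mulVec y) ⁻¹'
        Set.pi Set.univ fun _ => Set.Ico (-(1 : ℝ) / 2) (1 / 2) := by
      ext y
      simp only [hS, hinv, Set.mem_preimage, Set.mem_univ_pi]
      exact ⟨fun ⟨t, ht, h⟩ => h ▸ ht, fun h => ⟨_, h, rfl⟩⟩
    have hSm : MeasurableSet S := by
      rw [hSpre]
      exact hcont.measurable (MeasurableSet.univ_pi fun _ => measurableSet_Ico)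
    have hpos : 0 < |A.det|⁻¹ := inv_pos.2 (abs_pos.2 hdet.ne_zero)
    have hmv : ∀ t : Fin d → ℝ, A.mulVec t = ∑ j, t j • fun i => Ξ i j := by
      intro t
      ext i
      simp [Matrix.mulVec, dotProduct, hA, mul_comm]
    refine ⟨?_, ⟨|A.det|⁻¹, fun x => ?_⟩, fun x hx => ?_, fun x hx => ?_, ?_⟩
    · rw [hM]
      exact stronglyMeasurable_const.indicator hSm
    · rw [hM]
      exact ⟨Set.indicator_nonneg (fun _ _ => hpos.le) x,
        Set.indicator_le_self' (fun _ _ => hpos.le) x⟩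
    · rw [hM] at hx
      obtain ⟨t, ht, rfl⟩ := Set.mem_of_indicator_ne_zero hx
      exact ⟨t, fun i => Set.Ico_subset_Icc_self (ht i), hmv t⟩
    · obtain ⟨a, ha0, ha1, z, ⟨t, ht, rfl⟩, rfl⟩ := exists_smul_eq_of_mem_interior hx
      rw [hM, Set.indicator_of_mem]
      · exact hpos
      · refine ⟨a • t, fun i => Set.Ioo_subset_Ico_self (smul_mem_Ioo_of_mem_Icc ha0 ha1 (ht i)),
          ?_⟩
        rw [Matrix.mulVec_smul, hmv]
        rfl
    · rw [mem_interior]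
      refine ⟨(fun y => A⁻¹.mulVec y) ⁻¹' Set.pi Set.univ fun _ =>
        Set.Ioo (-(1 : ℝ) / 2) (1 / 2), ?_, ?_, ?_⟩
      · intro y hy
        refine ⟨A⁻¹.mulVec y, fun i => Set.Ioo_subset_Icc_self (hy i trivial), ?_⟩
        exact ((hinv y _).2 rfl).trans (hmv _)
      · exact (isOpen_set_pi Set.finite_univ fun _ _ => isOpen_Ioo).preimage hcont
      · simp only [Set.mem_preimage, Matrix.mulVec_zero, Set.mem_univ_pi]
        intro i
        constructor <;> norm_num
  | succ n ih =>
    intro Ξ hΞ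
    set ξ : Fin d → ℝ := fun i => Ξ i (Fin.last (d + n)) with hξ
    set Ξ' : Matrix (Fin d) (Fin (d + n)) ℝ := fun i j => Ξ i (Fin.castSucc j) with hΞ'
    obtain ⟨hmeas, ⟨C, hC⟩, hsupp, hpos, hzero⟩ := ih Ξ' hΞ
    have hmem : ∀ y, y ∈ zonotope (-(1 : ℝ) / 2) (1 / 2) (fun j i => Ξ i j) ↔
        ∃ s ∈ Set.Icc (-(1 : ℝ) / 2) (1 / 2),
          y - s • ξ ∈ zonotope (-(1 : ℝ) / 2) (1 / 2) fun j i => Ξ' i j :=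
      fun y => mem_zonotope_succ (n := d + n)
    have hM : ∀ x, boxSplineAux d (n + 1) Ξ x =
        ∫ t in (-(1 : ℝ) / 2)..(1 / 2), boxSplineAux d n Ξ' (x - t • ξ) := fun _ => rfl
    have hle : -(1 : ℝ) / 2 ≤ 1 / 2 := by norm_num
    have hslice : ∀ x, IntervalIntegrable (fun t : ℝ => boxSplineAux d n Ξ' (x - t • ξ)) volume
        (-(1 : ℝ) / 2) (1 / 2) := by
      intro x
      have hsm : StronglyMeasurable fun t : ℝ => boxSplineAux d n Ξ' (x - t • ξ) :=
        hmeas.comp_measurable (by fun_prop)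
      refine (intervalIntegrable_const (c := C)).mono_fun hsm.aestronglyMeasurable ?_
      refine Filter.Eventually.of_forall fun t => ?_
      obtain ⟨h1, h2⟩ := hC (x - t • ξ)
      simp only [Real.norm_eq_abs]
      rw [abs_of_nonneg h1, abs_of_nonneg (h1.trans h2)]
      exact h2
    refine ⟨?_, ⟨C, fun x => ⟨?_, ?_⟩⟩, fun x hx => ?_, fun x hx => ?_, ?_⟩
    · have h : StronglyMeasurable (Function.uncurry fun (x : Fin d → ℝ) (t : ℝ) =>
          boxSplineAux d n Ξ' (x - t • ξ)) :=
        hmeas.comp_measurable (g := fun p : (Fin d → ℝ) × ℝ => p.1 - p.2 • ξ) (by fun_prop)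
      have h2 := h.integral_prod_right (ν := volume.restrict (Set.Ioc (-(1 : ℝ) / 2) (1 / 2)))
      convert h2 using 1
      ext x
      rw [hM, intervalIntegral.integral_of_le hle]
    · rw [hM]
      exact intervalIntegral.integral_nonneg hle fun t _ => (hC _).1
    · rw [hM]
      have := intervalIntegral.integral_mono_on hle (hslice x) (intervalIntegrable_const (c := C))
        fun t _ => (hC _).2
      refine this.trans_eq ?_
      rw [intervalIntegral.integral_const]
      norm_num
    · by_contra hx'
      refine hx ?_
      rw [hM]
      refine intervalIntegral.integral_zero_ae (Filter.Eventually.of_forall fun t ht => ?_)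
      rw [Set.uIoc_of_le hle] at ht
      by_contra h
      exact hx' ((hmem x).2 ⟨t, Set.Ioc_subset_Icc_self ht, hsupp _ h⟩)
    · rw [hM, intervalIntegral.integral_pos_iff_support_of_nonneg_ae
        (Filter.Eventually.of_forall fun t => (hC _).1) (hslice x)]
      refine ⟨by norm_num, ?_⟩
      obtain ⟨a, ha0, ha1, z, hz, rfl⟩ := exists_smul_eq_of_mem_interior hx
      obtain ⟨t, ht, hzt⟩ := (hmem z).1 hz
      set U : Set ℝ := (fun s : ℝ => a • z - s • ξ) ⁻¹'
        interior (zonotope (-(1 : ℝ) / 2) (1 / 2) fun j i => Ξ' i j) ∩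
          Set.Ioo (-(1 : ℝ) / 2) (1 / 2) with hU
      have hUo : IsOpen U := (isOpen_interior.preimage (by fun_prop)).inter isOpen_Ioo
      have hUne : U.Nonempty := by
        refine ⟨a * t, ?_, smul_mem_Ioo_of_mem_Icc ha0 ha1 ht⟩
        have := (convex_zonotope _ _ _).combo_interior_self_mem_interior hzero hzt
          (sub_pos.2 ha1) ha0.le (sub_add_cancel 1 a)
        rw [Set.mem_preimage]
        convert this using 1
        module
      refine (hUo.measure_pos volume hUne).trans_le (measure_mono ?_)
      exact fun s hs => ⟨(hpos _ hs.1).ne', Set.Ioo_subset_Ioc_self hs.2⟩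
    · refine interior_mono (fun y hy => ?_) hzero
      exact (hmem y).2 ⟨0, ⟨by norm_num, by norm_num⟩, by simpa using hy⟩

open scoped Pointwise in
/-- Averaging over a fundamental domain: if almost every point is covered by exactly `c`
integer translates of `Z`, then `Z` has volume `c`. -/
theorem volume_eq_of_ae_encard_eq {d : ℕ} {Z : Set (Fin d → ℝ)} (hZ : MeasurableSet Z) {c : ℕ∞}
    (h : ∀ᵐ x : Fin d → ℝ,
      {p | p ∈ (Submodule.span ℤ (Set.range (Pi.basisFun ℝ (Fin d)))).toAddSubgroup ∧
        x - p ∈ Z}.encard = c) :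
    volume Z = c := by
  set L := (Submodule.span ℤ (Set.range (Pi.basisFun ℝ (Fin d)))).toAddSubgroup with hL
  set D := ZSpan.fundamentalDomain (Pi.basisFun ℝ (Fin d)) with hD
  have hfund : IsAddFundamentalDomain L D volume :=
    ZSpan.isAddFundamentalDomain' (Pi.basisFun ℝ (Fin d)) volume
  have : Countable L :=
    inferInstanceAs (Countable (Submodule.span ℤ (Set.range (Pi.basisFun ℝ (Fin d)))))
  have hDvol : volume D = 1 := by
    rw [hD, ZSpan.fundamentalDomain_pi_basisFun]
    simp [volume_pi]
  have hmeas : ∀ g : L, MeasurableSet (g +ᵥ Z) := fun g => hZ.const_vadd g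
  have hcount : ∀ x : Fin d → ℝ, ∑' g : L, (g +ᵥ Z).indicator (fun _ => (1 : ENNReal)) x =
      ({p | p ∈ L ∧ x - p ∈ Z}.encard : ENNReal) := by
    intro x
    have himg : {p | p ∈ L ∧ x - p ∈ Z} = Subtype.val '' {g : L | x ∈ g +ᵥ Z} := by
      ext p
      simp only [Set.mem_ofPred_eq, Set.mem_image, Subtype.exists, Set.mem_vadd_set_iff_neg_vadd_mem,
        exists_and_right, exists_eq_right, AddSubgroup.vadd_def, vadd_eq_add,
        neg_add_eq_sub, exists_prop]
    rw [himg, Subtype.val_injective.encard_image, ← ENNReal.tsum_set_one,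
      tsum_subtype _ fun _ : L => (1 : ENNReal)]
    rfl
  rw [hfund.measure_eq_tsum]
  calc ∑' g : L, volume ((g +ᵥ Z) ∩ D)
      = ∑' g : L, ∫⁻ x in D, (g +ᵥ Z).indicator (fun _ => 1) x := by
        congr 1
        ext g
        rw [lintegral_indicator_const (hmeas g), Measure.restrict_apply (hmeas g), one_mul]
    _ = ∫⁻ x in D, ∑' g : L, (g +ᵥ Z).indicator (fun _ => 1) x :=
        (lintegral_tsum fun g => (measurable_const.indicator (hmeas g)).aemeasurable).symm
    _ = ∫⁻ _ in D, (c : ENNReal) :=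
        lintegral_congr_ae (ae_restrict_of_ae (h.mono fun x hx => (hcount x).trans (by rw [hx])))
    _ = c := by rw [setLIntegral_const, hDvol, mul_one]

/-- Almost every point is covered by exactly `vol Z` integer translates of a centered zonotope `Z`
generated by integer vectors. -/
theorem ae_encard_eq_volume_zonotope {d m : ℕ} (v : Fin m → Fin d → ℝ)
    (hv : ∀ i, v i ∈ (Submodule.span ℤ (Set.range (Pi.basisFun ℝ (Fin d)))).toAddSubgroup) :
    ∀ᵐ x : Fin d → ℝ,
      ({p | p ∈ (Submodule.span ℤ (Set.range (Pi.basisFun ℝ (Fin d)))).toAddSubgroup ∧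
        x - p ∈ zonotope (-(1 : ℝ) / 2) (1 / 2) v}.encard : ENNReal) =
      volume (zonotope (-(1 : ℝ) / 2) (1 / 2) v) := by
  set L := (Submodule.span ℤ (Set.range (Pi.basisFun ℝ (Fin d)))).toAddSubgroup with hL
  have : Countable L :=
    inferInstanceAs (Countable (Submodule.span ℤ (Set.range (Pi.basisFun ℝ (Fin d)))))
  obtain ⟨c, hc⟩ := exists_ae_encard_eq m d L v hv
  have hshift : ∀ y, y ∈ zonotope (-(1 : ℝ) / 2) (1 / 2) v ↔
      y - (-(1 : ℝ) / 2) • ∑ i, v i ∈ zonotope 0 1 v := by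
    intro y
    rw [← zonotope_add]
    norm_num
  have hc' : ∀ᵐ x : Fin d → ℝ,
      {p | p ∈ L ∧ x - p ∈ zonotope (-(1 : ℝ) / 2) (1 / 2) v}.encard = c := by
    have := (measurePreserving_sub_right volume
      ((-(1 : ℝ) / 2) • ∑ i, v i)).quasiMeasurePreserving.ae hc
    filter_upwards [this] with x hx
    rw [← hx]
    simp only [hshift, sub_right_comm]
  have hvol := volume_eq_of_ae_encard_eq (isCompact_zonotope _ _ v).measurableSet hc'
  filter_upwards [hc'] with x hx
  rw [hx, hvol]

/-- for almost every `x`, the number of lattice shifts of the centered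
box spline that are nonzero at `x` equals the volume of the zonotope `Ξ [-1/2,1/2]^m`. -/
theorem boxSpline_stencil_size {d m : ℕ} (hd : 1 ≤ d) (hdm : d ≤ m)
    (Ξ : Matrix (Fin d) (Fin m) ℤ)
    (hΞ : LinearIndependent ℝ fun j : Fin d => fun i =>
      (Ξ.map (Int.cast : ℤ → ℝ)) i (Fin.castLE hdm j)) :
    ∀ᵐ x : Fin d → ℝ ∂(volume : Measure (Fin d → ℝ)),
      {j : Fin d → ℤ |
        boxSpline hdm (Ξ.map (Int.cast : ℤ → ℝ)) (x - fun i => (j i : ℝ)) ≠ 0}.Finite ∧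
      ({j : Fin d → ℤ |
          boxSpline hdm (Ξ.map (Int.cast : ℤ → ℝ)) (x - fun i => (j i : ℝ)) ≠ 0}.ncard : ℝ) =
        (volume {y : Fin d → ℝ | ∃ t : Fin m → ℝ,
          (∀ i, t i ∈ Set.Icc (-(1:ℝ)/2) (1/2)) ∧
          y = (Ξ.map (Int.cast : ℤ → ℝ)).mulVec t}).toReal := by

  set v : Fin m → Fin d → ℝ := fun j i => (Ξ i j : ℝ) with hv
  set Z := zonotope (-(1 : ℝ) / 2) (1 / 2) v with hZ
  have hZset : {y : Fin d → ℝ | ∃ t : Fin m → ℝ, (∀ i, t i ∈ Set.Icc (-(1:ℝ)/2) (1/2)) ∧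
      y = (Ξ.map (Int.cast : ℤ → ℝ)).mulVec t} = Z := by
    have hmv : ∀ t : Fin m → ℝ, (Ξ.map (Int.cast : ℤ → ℝ)).mulVec t = ∑ j, t j • v j := by
      intro t
      ext i
      simp [Matrix.mulVec, dotProduct, hv, mul_comm]
    simp only [hmv]
    rfl
  obtain ⟨-, -, hsupp, hpos, -⟩ := boxSplineAux_properties d (m - d)
    (fun i j => (Ξ.map (Int.cast : ℤ → ℝ)) i (Fin.cast (Nat.add_sub_cancel' hdm) j)) hΞ
  have hcols : zonotope (-(1 : ℝ) / 2) (1 / 2) (fun j i =>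
      (Ξ.map (Int.cast : ℤ → ℝ)) i (Fin.cast (Nat.add_sub_cancel' hdm) j)) = Z :=
    zonotope_comp_equiv _ _ v (finCongr (Nat.add_sub_cancel' hdm))
  rw [hcols] at hsupp hpos
  set L := (Submodule.span ℤ (Set.range (Pi.basisFun ℝ (Fin d)))).toAddSubgroup with hL
  have hmemL : ∀ p, p ∈ L ↔ ∃ j : Fin d → ℤ, (fun i => (j i : ℝ)) = p := by
    intro p
    rw [hL, Submodule.mem_toAddSubgroup, Module.Basis.mem_span_iff_repr_mem]
    simp only [Pi.basisFun_repr, Set.mem_range, eq_intCast]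
    exact ⟨fun h => ⟨fun i => (h i).choose, funext fun i => (h i).choose_spec⟩,
      fun ⟨j, hj⟩ i => ⟨j i, congrFun hj i⟩⟩
  have hfront : volume (frontier Z) = 0 := (convex_zonotope _ _ v).addHaar_frontier volume
  have hgood : ∀ᵐ x : Fin d → ℝ, ∀ j : Fin d → ℤ, x - (fun i => (j i : ℝ)) ∉ frontier Z :=
    ae_all_iff.2 fun j => (measurePreserving_sub_right volume _).quasiMeasurePreserving.ae
      (measure_eq_zero_iff_ae_notMem.1 hfront)
  have hcount := ae_encard_eq_volume_zonotope v fun i => (hmemL _).2 ⟨fun k => Ξ k i, rfl⟩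
  have hfin : volume Z ≠ ⊤ := (isCompact_zonotope _ _ v).measure_lt_top.ne
  filter_upwards [hgood, hcount] with x hx hxc
  rw [hZset]
  set J := {j : Fin d → ℤ |
    boxSpline hdm (Ξ.map (Int.cast : ℤ → ℝ)) (x - fun i => (j i : ℝ)) ≠ 0} with hJ
  have hinj : Function.Injective fun (j : Fin d → ℤ) (i : Fin d) => (j i : ℝ) :=
    fun j j' h => funext fun i => Int.cast_injective (congrFun h i)
  have himg : (fun (j : Fin d → ℤ) (i : Fin d) => (j i : ℝ)) '' J = {p | p ∈ L ∧ x - p ∈ Z} := by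
    ext p
    constructor
    · rintro ⟨j, hj, rfl⟩
      exact ⟨(hmemL _).2 ⟨j, rfl⟩, hsupp _ hj⟩
    · rintro ⟨hp, hpZ⟩
      obtain ⟨j, rfl⟩ := (hmemL p).1 hp
      refine ⟨j, (hpos _ ?_).ne', rfl⟩
      by_contra hint
      exact hx j ⟨subset_closure hpZ, hint⟩
  rw [← himg, hinj.encard_image] at hxc
  have hJfin : J.Finite := by
    rw [← Set.encard_ne_top_iff]
    intro htop
    exact hfin (by rw [← hxc, htop, ENat.toENNReal_top])
  refine ⟨hJfin, ?_⟩
  rw [← hxc, ← hJfin.cast_ncard_eq, ENat.toENNReal_coe, ENNReal.toReal_natCast]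
end
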